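/- For every even integer q ≥ 2 there exists β* > 0 such that for every real β with |β| ≤ β*: lim_{n→∞} (1/n) log Mₙ = −log t* + Φ(t*), where for each n, Mₙ is the coefficient of zⁿ in the Taylor expansion at 0 of M(z) = M₀(z)·ΔM(z) (with M₀, ΔM depending on n), and t* ∈ (1/2, 3/2) is the unique solution of t*·Φ'(t*) = 1. -/

import Mathlib

open MeasureTheory Filter

noncomputable section

namespace SYK

attribute [local instance] Classical.propDecidable

/-- The chord crossing sign `K(x,y)`. -/
def K (x y : ℝ × ℝ) : ℝ :=
  if (x.1 < y.1 ∧ y.1 < x.2 ∧ x.2 < y.2) ∨ (y.1 < x.1 ∧ x.1 < y.2 ∧ y.2 < x.2) then -1 else 1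

lemma K_symm (x y : ℝ × ℝ) : K x y = K y x := if_congr or_comm rfl rfl

/-- The law of `(min U₁ U₂, max U₁ U₂)` for `U₁, U₂` i.i.d. uniform on `[0,1]`. -/
def nu : Measure (ℝ × ℝ) :=
  Measure.map (fun p : ℝ × ℝ => (min p.1 p.2, max p.1 p.2))
    (volume.restrict (Set.Icc (0 : ℝ) 1 ×ˢ Set.Icc (0 : ℝ) 1))

/-- Two vertices are related if some hyperedge of `E` contains both. -/
def edgeRel {N : ℕ} (E : Finset (Finset (Fin N))) (a b : Fin N) : Prop :=
  ∃ e ∈ E, a ∈ e ∧ b ∈ e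

/-- A hypergraph on the full vertex set `Fin N` is connected. -/
def HGConnected {N : ℕ} (E : Finset (Finset (Fin N))) : Prop :=
  ∀ a b : Fin N, Relation.ReflTransGen (edgeRel E) a b

/-- `E` is a `q`-uniform hypertree on the vertex set `Fin N`. -/
def IsHypertree (q N : ℕ) (E : Finset (Finset (Fin N))) : Prop :=
  (∀ e ∈ E, e.card = q) ∧ HGConnected E ∧ (q - 1) * E.card = N - 1

/-- The set `𝒯_N` of `q`-uniform hypertrees on `{1,…,N}`. -/
def trees (q N : ℕ) : Finset (Finset (Finset (Fin N))) :=
  Finset.univ.filter (IsHypertree q N)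

/-- Sign contributed by an unordered pair of hyperedges with chords given by `X`. -/
def pairSign {N : ℕ} (X : Finset (Fin N) → ℝ × ℝ) : Sym2 (Finset (Fin N)) → ℝ :=
  Sym2.lift ⟨fun e₁ e₂ => if Odd (e₁ ∩ e₂).card then K (X e₁) (X e₂) else 1,
    fun e₁ e₂ => if_congr (by rw [Finset.inter_comm]) (K_symm _ _) rfl⟩

/-- `B_H(X)`: the product of `K(X(e₁),X(e₂))` over unordered pairs of distinct
hyperedges sharing an odd number of vertices. -/
def BE {N : ℕ} (E : Finset (Finset (Fin N))) (X : Finset (Fin N) → ℝ × ℝ) : ℝ :=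
  ∏ p ∈ E.sym2.filter (fun p => ¬ p.IsDiag), pairSign X p

/-- `b_H`: the expectation of `B_H(X)` over i.i.d. chords with law `ν`. -/
def bT {N : ℕ} (E : Finset (Finset (Fin N))) : ℝ :=
  ∫ X : Finset (Fin N) → ℝ × ℝ, BE E X ∂(Measure.pi fun _ => nu)

/-- `ρ = ((q−1)! β² / 2^{q+1})^{1/(q−1)}`. -/
def rho (q : ℕ) (β : ℝ) : ℝ :=
  (((q - 1).factorial * β ^ 2 / 2 ^ (q + 1) : ℝ)) ^ ((q : ℝ) - 1)⁻¹

/-- `μ_v = (ρ^{v−1}/v!) Σ_{T ∈ 𝒯_v} b_T`. -/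
def mu (q : ℕ) (β : ℝ) (v : ℕ) : ℝ :=
  rho q β ^ (v - 1) / v.factorial * ∑ E ∈ trees q v, bT E

/-- The power series `Φ(z) = Σ_{v ≥ 1} μ_v z^v` (complex version). -/
def PhiC (q : ℕ) (β : ℝ) (z : ℂ) : ℂ :=
  ∑' v : ℕ, (mu q β (v + 1) : ℂ) * z ^ (v + 1)

/-- The power series `Φ(t) = Σ_{v ≥ 1} μ_v t^v` (real version). -/
def PhiR (q : ℕ) (β : ℝ) (t : ℝ) : ℝ :=
  ∑' v : ℕ, mu q β (v + 1) * t ^ (v + 1)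

/-- The quadratic form on `ℂ^N` with `Q(x) = ½ Σ x_i²`, so that the Clifford
relation reads `ψ_i ψ_j + ψ_j ψ_i = δ_{ij}`. -/
def Qf (N : ℕ) : QuadraticForm ℂ (Fin N → ℂ) :=
  QuadraticMap.weightedSumSquares ℂ (fun _ : Fin N => (1 / 2 : ℂ))

/-- The complex Clifford algebra with `N` Majorana generators. -/
abbrev Cliff (N : ℕ) := CliffordAlgebra (Qf N)

/-- The Majorana generator `ψ_i`. -/
def psi {N : ℕ} (i : Fin N) : Cliff N :=
  CliffordAlgebra.ι (Qf N) (Pi.single i 1)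

/-- `ψ_I = i^{q/2} ψ_{i₁} ⋯ ψ_{i_q}` for `I = {i₁ < ⋯ < i_q}`. -/
def psiSet {N : ℕ} (q : ℕ) (I : Finset (Fin N)) : Cliff N :=
  (Complex.I) ^ (q / 2) • ((I.sort (· ≤ ·)).map psi).prod

/-- The sign `B(I₁,…,I_m) ∈ {±1}` determined by
`ψ_{I₁} ⋯ ψ_{I_m} = B(I₁,…,I_m) 2^{-qm/2} 1`. -/
def signB {N : ℕ} (q : ℕ) (l : List (Finset (Fin N))) : ℝ :=
  if (l.map (psiSet q)).prod = (((2 : ℂ) ^ (q * l.length / 2))⁻¹) • (1 : Cliff N) then 1 else -1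

/-- `b(H) = Σ_{(I₁,…,I_m) ∈ w(H)} B(I₁,…,I_m)` for a multi-hypergraph with
multiplicity function `r` and total multiplicity `m`, the sum running over
all ordered sequences in which each hyperedge `e` appears exactly `r e` times. -/
def bMulti {N : ℕ} (q : ℕ) (r : Finset (Fin N) → ℕ) (m : ℕ) : ℝ :=
  ∑ f : Fin m → Finset (Fin N),
    if (∀ e, (Finset.univ.filter (fun i => f i = e)).card = r e)
    then signB q (List.ofFn f) else 0

/-- `r` describes a member of `ℋ_{v,Δ}`: a connected `q`-uniform multi-hypergraph on the
vertex set `{1,…,v}` with even multiplicities and total multiplicity `2(v−1+Δ)/(q−1)`. -/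
def IsMultiHG (q v Δ : ℕ) (r : Finset (Fin v) → ℕ) : Prop :=
  (∀ e, r e ≠ 0 → e.card = q) ∧ (∀ e, Even (r e)) ∧
    (∀ a b : Fin v,
      Relation.ReflTransGen (fun a b => ∃ e, r e ≠ 0 ∧ a ∈ e ∧ b ∈ e) a b) ∧
    (q - 1) * (∑ e, r e) = 2 * (v - 1 + Δ)

/-- `σ = ((q−1)!/n^{q−1})^{1/2}`. -/
def sigma (q n : ℕ) : ℝ := Real.sqrt ((q - 1).factorial / (n : ℝ) ^ (q - 1))

/-- `μ_{v,Δ} = (n^{v−1}/v!) Σ_{H ∈ ℋ_{v,Δ}} (β 2^{-q/2} σ)^{m(H)} b(H)/m(H)!`.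
Multi-hypergraphs are encoded by their multiplicity functions; since the total
multiplicity is at most `2(v−1+Δ)`, multiplicities are encoded in `Fin (2(v−1+Δ)+1)`. -/
def muVD (q n : ℕ) (β : ℝ) (v Δ : ℕ) : ℝ :=
  (n : ℝ) ^ (v - 1) / v.factorial *
    ∑ r : Finset (Fin v) → Fin (2 * (v - 1 + Δ) + 1),
      if IsMultiHG q v Δ (fun e => (r e : ℕ)) then
        (β * ((2 : ℝ) ^ (q / 2))⁻¹ * sigma q n) ^ (∑ e, (r e : ℕ)) *
          bMulti q (fun e => (r e : ℕ)) (∑ e, (r e : ℕ)) / (∑ e, (r e : ℕ)).factorial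
      else 0

/-- `M₀(z) = exp(n Σ_{v ≥ 1} μ_{v,0} z^v)`. -/
def M0 (q n : ℕ) (β : ℝ) (z : ℂ) : ℂ :=
  Complex.exp ((n : ℂ) * ∑' v : ℕ, (muVD q n β (v + 1) 0 : ℂ) * z ^ (v + 1))

/-- `ΔM(z) = exp(n Σ_{1 ≤ v ≤ n} Σ_{Δ ≥ 1} μ_{v,Δ} z^v)`. -/
def DeltaM (q n : ℕ) (β : ℝ) (z : ℂ) : ℂ :=
  Complex.exp ((n : ℂ) *
    ∑ v ∈ Finset.Icc 1 n, ∑' Δ : ℕ, (muVD q n β v (Δ + 1) : ℂ) * z ^ v)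

/-- `M = M₀ · ΔM`. -/
def Mfun (q n : ℕ) (β : ℝ) (z : ℂ) : ℂ := M0 q n β z * DeltaM q n β z

/-- `Mₙ`: the coefficient of `zⁿ` in the Taylor expansion of `M` at `0`. -/
def Mcoef (q n : ℕ) (β : ℝ) : ℂ := iteratedDeriv n (Mfun q n β) 0 / n.factorial

lemma cast_succ_le_two_pow (v : ℕ) : ((v : ℝ) + 1) ≤ 2 ^ v := by
  exact_mod_cast Nat.lt_two_pow_self (n := v)

/-- The geometric majorant `2 (4/25)^v` of the weighted coefficients. -/
lemma hasSum_majorant : HasSum (fun v : ℕ => 2 * (4 / 25 : ℝ) ^ v) (50 / 21) := by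
  have := (hasSum_geometric_of_lt_one (r := (4 / 25 : ℝ)) (by norm_num) (by norm_num)).mul_left 2
  rwa [show 2 * (1 - 4 / 25 : ℝ)⁻¹ = 50 / 21 by norm_num] at this

lemma weighted_coeff_le {a : ℕ → ℝ} (ha : ∀ v, |a v| ≤ (1 / 100) ^ v) (v : ℕ) :
    |a v| * ((v : ℝ) + 1) ^ 3 * 2 ^ (v + 1) ≤ 2 * (4 / 25) ^ v := by
  have h1 : ((v : ℝ) + 1) ^ 3 ≤ 8 ^ v := by
    calc ((v : ℝ) + 1) ^ 3 ≤ (2 ^ v) ^ 3 := by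
          gcongr; exact cast_succ_le_two_pow v
      _ = 8 ^ v := by rw [← pow_mul, mul_comm, pow_mul]; norm_num
  calc |a v| * ((v : ℝ) + 1) ^ 3 * 2 ^ (v + 1) ≤ (1 / 100) ^ v * 8 ^ v * 2 ^ (v + 1) := by
        gcongr; exact ha v
    _ = 2 * (4 / 25) ^ v := by
        rw [pow_succ, show (4 / 25 : ℝ) = 1 / 100 * 8 * 2 by norm_num, mul_pow, mul_pow]; ring

lemma abs_coeff_mul_le {a : ℕ → ℝ} (ha : ∀ v, |a v| ≤ (1 / 100) ^ v) {t : ℝ} (ht0 : 0 ≤ t)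
    (ht2 : t ≤ 2) (v : ℕ) {y u : ℝ} (hy : |y| ≤ ((v : ℝ) + 1) ^ 3 * u) :
    |a v * t ^ (v + 1) * y| ≤ 2 * (4 / 25) ^ v * u := by
  have hu : 0 ≤ u := by
    by_contra h
    have : ((v : ℝ) + 1) ^ 3 * u < 0 := mul_neg_of_pos_of_neg (by positivity) (by linarith)
    linarith [abs_nonneg y]
  rw [abs_mul, abs_mul, abs_of_nonneg (pow_nonneg ht0 _)]
  calc |a v| * t ^ (v + 1) * |y| ≤ |a v| * 2 ^ (v + 1) * (((v : ℝ) + 1) ^ 3 * u) := by gcongr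
    _ = |a v| * ((v : ℝ) + 1) ^ 3 * 2 ^ (v + 1) * u := by ring
    _ ≤ _ := mul_le_mul_of_nonneg_right (weighted_coeff_le ha v) hu

/-- A series dominated by the majorant differs little from its leading term. -/
lemma abs_tsum_sub_zero_le {f : ℕ → ℝ} {u : ℝ} (hf : ∀ v, |f v| ≤ 2 * (4 / 25) ^ v * u) :
    |(∑' v, f v) - f 0| ≤ 8 / 21 * u := by
  have hs : Summable f := Summable.of_norm_bounded (hasSum_majorant.mul_right u).summable hf
  have h1 := (hasSum_nat_add_iff' 1).2 (hasSum_majorant.mul_right u)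
  have h2 := tsum_of_norm_bounded h1 (f := fun v => f (v + 1)) (fun v => hf (v + 1))
  rw [hs.tsum_eq_zero_add, add_sub_cancel_left, ← Real.norm_eq_abs]
  refine h2.trans (le_of_eq ?_)
  simp; ring

/-- The function `t Φ'(t)` as a series. -/
def tDeriv (a : ℕ → ℝ) (t : ℝ) : ℝ := ∑' v : ℕ, a v * t ^ (v + 1) * ((v : ℝ) + 1)

lemma cast_succ_le_cube (v : ℕ) : ((v : ℝ) + 1) ≤ ((v : ℝ) + 1) ^ 3 :=
  le_self_pow₀ (by linarith [(Nat.cast_nonneg v : (0 : ℝ) ≤ v)]) (by norm_num)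

lemma cast_succ_sq_le_cube (v : ℕ) : ((v : ℝ) + 1) ^ 2 ≤ ((v : ℝ) + 1) ^ 3 :=
  pow_le_pow_right₀ (by linarith [(Nat.cast_nonneg v : (0 : ℝ) ≤ v)]) (by norm_num)

lemma summable_coeff {a : ℕ → ℝ} (ha : ∀ v, |a v| ≤ (1 / 100) ^ v) {t : ℝ} (ht0 : 0 ≤ t)
    (ht2 : t ≤ 2) : Summable (fun v => a v * t ^ (v + 1)) := by
  refine Summable.of_norm_bounded (hasSum_majorant.mul_right 1).summable fun v => ?_
  have := abs_coeff_mul_le ha ht0 ht2 v (y := 1) (u := 1) (by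
    have := cast_succ_le_cube v
    have := (Nat.cast_nonneg v : (0 : ℝ) ≤ v)
    simp; linarith)
  simpa using this

lemma summable_coeff_mul_succ {a : ℕ → ℝ} (ha : ∀ v, |a v| ≤ (1 / 100) ^ v) {t : ℝ} (ht0 : 0 ≤ t)
    (ht2 : t ≤ 2) : Summable (fun v => a v * t ^ (v + 1) * ((v : ℝ) + 1)) := by
  refine Summable.of_norm_bounded (hasSum_majorant.mul_right 1).summable fun v => ?_
  refine abs_coeff_mul_le ha ht0 ht2 v ?_
  rw [mul_one, abs_of_nonneg (by positivity)]
  exact cast_succ_le_cube v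

lemma summable_coeff_mul_succ_sq {a : ℕ → ℝ} (ha : ∀ v, |a v| ≤ (1 / 100) ^ v) {t : ℝ}
    (ht0 : 0 ≤ t) (ht2 : t ≤ 2) :
    Summable (fun v => a v * t ^ (v + 1) * ((v : ℝ) + 1) ^ 2) := by
  refine Summable.of_norm_bounded (hasSum_majorant.mul_right 1).summable fun v => ?_
  refine abs_coeff_mul_le ha ht0 ht2 v ?_
  rw [mul_one, abs_of_nonneg (by positivity)]
  exact cast_succ_sq_le_cube v

lemma mul_deriv_tsum_eq {a : ℕ → ℝ} (ha : ∀ v, |a v| ≤ (1 / 100) ^ v) {t : ℝ}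
    (ht : t ∈ Set.Ioo (1 / 2 : ℝ) (3 / 2)) :
    t * deriv (fun t => ∑' v : ℕ, a v * t ^ (v + 1)) t = tDeriv a t := by
  have hd : HasDerivAt (fun t => ∑' v : ℕ, a v * t ^ (v + 1))
      (∑' v : ℕ, a v * (((v : ℝ) + 1) * t ^ v)) t := by
    refine hasDerivAt_tsum_of_isPreconnected (u := fun v : ℕ => 2 * (4 / 25 : ℝ) ^ v)
      (t := Set.Ioo 0 2) (y₀ := 1)
      (g := fun v t => a v * t ^ (v + 1)) (g' := fun v t => a v * (((v : ℝ) + 1) * t ^ v))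
      hasSum_majorant.summable isOpen_Ioo isPreconnected_Ioo ?_ ?_ ?_ ?_ ?_
    · intro v y _
      have := (hasDerivAt_pow (v + 1) y).const_mul (a v)
      simpa using this
    · intro v y hy
      rw [Real.norm_eq_abs, abs_mul, abs_mul, abs_of_nonneg (by positivity : (0 : ℝ) ≤ v + 1),
        abs_of_nonneg (pow_nonneg hy.1.le v)]
      have h2 : y ^ v ≤ 2 ^ (v + 1) := by
        calc y ^ v ≤ 2 ^ v := by gcongr; exacts [hy.1.le, hy.2.le]
          _ ≤ 2 ^ (v + 1) := by gcongr <;> norm_num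
      calc |a v| * (((v : ℝ) + 1) * y ^ v) ≤ |a v| * (((v : ℝ) + 1) ^ 3 * 2 ^ (v + 1)) := by
            have := cast_succ_le_cube v
            have := pow_nonneg hy.1.le v
            gcongr
        _ ≤ _ := by rw [← mul_assoc]; exact weighted_coeff_le ha v
    · norm_num
    · exact summable_coeff ha (by norm_num) (by norm_num)
    · exact ⟨by linarith [ht.1], by linarith [ht.2]⟩
  rw [hd.deriv, tDeriv, ← tsum_mul_left]
  congr 1; ext v; ring

lemma abs_tDeriv_sub_le {a : ℕ → ℝ} (h0 : a 0 = 1) (ha : ∀ v, |a v| ≤ (1 / 100) ^ v) {t : ℝ}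
    (ht0 : 0 ≤ t) (ht2 : t ≤ 2) : |tDeriv a t - t| ≤ 8 / 21 := by
  have := abs_tsum_sub_zero_le (f := fun v : ℕ => a v * t ^ (v + 1) * ((v : ℝ) + 1)) (u := 1)
    fun v => abs_coeff_mul_le ha ht0 ht2 v (by
      rw [mul_one, abs_of_nonneg (by positivity)]
      exact cast_succ_le_cube v)
  simpa [h0, tDeriv] using this

lemma continuousOn_tDeriv {a : ℕ → ℝ} (ha : ∀ v, |a v| ≤ (1 / 100) ^ v) :
    ContinuousOn (tDeriv a) (Set.Icc 0 2) := by
  refine continuousOn_tsum (u := fun v : ℕ => 2 * (4 / 25 : ℝ) ^ v * 1) (fun v => by fun_prop)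
    (hasSum_majorant.mul_right 1).summable ?_
  intro v t ht
  refine abs_coeff_mul_le ha ht.1 ht.2 v ?_
  rw [mul_one, abs_of_nonneg (by positivity)]
  exact cast_succ_le_cube v

lemma tDeriv_strictMonoOn {a : ℕ → ℝ} (h0 : a 0 = 1) (ha : ∀ v, |a v| ≤ (1 / 100) ^ v) :
    StrictMonoOn (tDeriv a) (Set.Icc 0 2) := by
  intro s hs t ht hst
  have hdiff : tDeriv a t - tDeriv a s
      = ∑' v : ℕ, a v * (t ^ (v + 1) - s ^ (v + 1)) * ((v : ℝ) + 1) := by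
    rw [tDeriv, tDeriv, ← (summable_coeff_mul_succ ha ht.1 ht.2).tsum_sub
      (summable_coeff_mul_succ ha hs.1 hs.2)]
    congr 1; ext v; ring
  have := abs_tsum_sub_zero_le
    (f := fun v : ℕ => a v * (t ^ (v + 1) - s ^ (v + 1)) * ((v : ℝ) + 1)) (u := t - s) (by
      intro v
      have h1 : |t ^ (v + 1) - s ^ (v + 1)| ≤ (t - s) * ((v : ℝ) + 1) * 2 ^ v := by
        have := abs_pow_sub_pow_le t s (v + 1)
        rw [abs_of_pos (sub_pos.2 hst)] at this
        refine this.trans ?_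
        push_cast
        have h3 : 0 ≤ t - s := by linarith
        gcongr
        · rw [abs_of_nonneg ht.1, abs_of_nonneg hs.1]
          exact max_le ht.2 hs.2
      rw [abs_mul, abs_mul, abs_of_nonneg (by positivity : (0 : ℝ) ≤ v + 1)]
      have h3 : 0 ≤ t - s := by linarith
      calc |a v| * |t ^ (v + 1) - s ^ (v + 1)| * ((v : ℝ) + 1)
          ≤ |a v| * ((t - s) * ((v : ℝ) + 1) * 2 ^ (v + 1)) * ((v : ℝ) + 1) := by
            gcongr
            refine h1.trans ?_
            gcongr <;> norm_num
        _ = |a v| * ((v : ℝ) + 1) ^ 2 * 2 ^ (v + 1) * (t - s) := by ring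
        _ ≤ |a v| * ((v : ℝ) + 1) ^ 3 * 2 ^ (v + 1) * (t - s) := by
            gcongr ?_ * ?_ * ?_ * ?_
            exact cast_succ_sq_le_cube v
        _ ≤ _ := mul_le_mul_of_nonneg_right (weighted_coeff_le ha v) h3)
  rw [← hdiff] at this
  simp [h0] at this
  have := (abs_le.1 this).1
  linarith

/-- The saddle point equation `t Φ'(t) = 1` has exactly one solution in `(1/2, 3/2)`. -/
lemma existsUnique_saddle {a : ℕ → ℝ} (h0 : a 0 = 1) (ha : ∀ v, |a v| ≤ (1 / 100) ^ v) :
    ∃! t : ℝ, t ∈ Set.Ioo (1 / 2 : ℝ) (3 / 2) ∧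
      t * deriv (fun t => ∑' v : ℕ, a v * t ^ (v + 1)) t = 1 := by
  have hsub : Set.Icc (1 / 2 : ℝ) (3 / 2) ⊆ Set.Icc 0 2 := Set.Icc_subset_Icc (by norm_num)
    (by norm_num)
  have h1 := abs_le.1 (abs_tDeriv_sub_le h0 ha (t := 1 / 2) (by norm_num) (by norm_num))
  have h2 := abs_le.1 (abs_tDeriv_sub_le h0 ha (t := 3 / 2) (by norm_num) (by norm_num))
  obtain ⟨t, ht, hte⟩ := intermediate_value_Ioo (by norm_num : (1 / 2 : ℝ) ≤ 3 / 2)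
    ((continuousOn_tDeriv ha).mono hsub)
    (show (1 : ℝ) ∈ _ from ⟨by linarith [h1.2], by linarith [h2.1]⟩)
  refine ⟨t, ⟨ht, by rw [mul_deriv_tsum_eq ha ht, hte]⟩, ?_⟩
  rintro s ⟨hs, hse⟩
  rw [mul_deriv_tsum_eq ha hs, ← hte] at hse
  exact (tDeriv_strictMonoOn h0 ha).injOn (hsub (Set.Ioo_subset_Icc_self hs))
    (hsub (Set.Ioo_subset_Icc_self ht)) hse

lemma abs_sin_nat_mul_le (m : ℕ) (x : ℝ) : |Real.sin (m * x)| ≤ m * |Real.sin x| := by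
  induction m with
  | zero => simp
  | succ k ih =>
    rw [Nat.cast_succ, add_mul, one_mul, Real.sin_add]
    calc |Real.sin (k * x) * Real.cos x + Real.cos (k * x) * Real.sin x|
        ≤ |Real.sin (k * x)| * |Real.cos x| + |Real.cos (k * x)| * |Real.sin x| := by
          rw [← abs_mul, ← abs_mul]; exact abs_add_le _ _
      _ ≤ |Real.sin (k * x)| * 1 + 1 * |Real.sin x| := by
          gcongr
          · exact Real.abs_cos_le_one _
          · exact Real.abs_cos_le_one _
      _ ≤ (k + 1) * |Real.sin x| := by linarith

lemma one_sub_cos_eq (x : ℝ) : 1 - Real.cos x = 2 * Real.sin (x / 2) ^ 2 := by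
  have h := Real.cos_sq (x / 2)
  rw [mul_div_cancel₀ x two_ne_zero] at h
  have h2 := Real.sin_sq_add_cos_sq (x / 2)
  linarith

lemma one_sub_cos_nat_mul_le (m : ℕ) (x : ℝ) :
    1 - Real.cos (m * x) ≤ (m : ℝ) ^ 2 * (1 - Real.cos x) := by
  rw [one_sub_cos_eq, one_sub_cos_eq, mul_div_assoc]
  have h := abs_sin_nat_mul_le m (x / 2)
  have h2 : |Real.sin (m * (x / 2))| ^ 2 ≤ (m * |Real.sin (x / 2)|) ^ 2 := by gcongr
  rw [mul_pow, sq_abs, sq_abs] at h2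
  linarith

lemma norm_exp_mul_I_taylor_le (x : ℝ) :
    ‖Complex.exp (x * Complex.I) - 1 - x * Complex.I + (x : ℂ) ^ 2 / 2‖ ≤ 4 * |x| ^ 3 := by
  rcases le_or_gt |x| 1 with h | h
  · have := Complex.exp_bound (x := x * Complex.I) (by simpa using h) (n := 3) (by norm_num)
    simp only [Finset.sum_range_succ, Finset.range_zero, Finset.sum_empty, norm_mul,
      Complex.norm_I, mul_one, Complex.norm_real, Real.norm_eq_abs] at this
    calc _ = ‖Complex.exp (x * Complex.I) - (0 + (x * Complex.I) ^ 0 / (Nat.factorial 0)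
          + (x * Complex.I) ^ 1 / (Nat.factorial 1) + (x * Complex.I) ^ 2 / (Nat.factorial 2))‖ := by
          congr 1
          simp [mul_pow]
          ring
      _ ≤ _ := this
      _ ≤ _ := by
          rw [mul_comm]
          gcongr
          norm_num [Nat.factorial]
  · have h1 : ‖Complex.exp (x * Complex.I)‖ = 1 := Complex.norm_exp_ofReal_mul_I x
    have h2 : |x| ≤ |x| ^ 3 := le_self_pow₀ h.le (by norm_num)
    have h3 : |x| ^ 2 ≤ |x| ^ 3 := pow_le_pow_right₀ h.le (by norm_num)
    calc _ ≤ ‖Complex.exp (x * Complex.I)‖ + ‖(1 : ℂ)‖ + ‖x * Complex.I‖ + ‖(x : ℂ) ^ 2 / 2‖ := by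
          refine (norm_add_le _ _).trans ?_
          gcongr
          refine (norm_sub_le _ _).trans ?_
          gcongr
          exact norm_sub_le _ _
      _ = 2 + |x| + |x| ^ 2 / 2 := by
          rw [h1]; simp; norm_num
      _ ≤ _ := by linarith

/-- The phase `Φ(t e^{iθ}) - Φ(t) - iθ`. -/
def phase (a : ℕ → ℝ) (t θ : ℝ) : ℂ :=
  (∑' v : ℕ, ((a v * t ^ (v + 1) : ℝ) : ℂ) *
    (Complex.exp ((((v : ℝ) + 1) * θ : ℝ) * Complex.I) - 1)) - θ * Complex.I

/-- The second moment `Σ (v+1)² a_v t^{v+1}`. -/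
def curvature (a : ℕ → ℝ) (t : ℝ) : ℝ := ∑' v : ℕ, a v * t ^ (v + 1) * ((v : ℝ) + 1) ^ 2

lemma curvature_pos {a : ℕ → ℝ} (h0 : a 0 = 1) (ha : ∀ v, |a v| ≤ (1 / 100) ^ v) {t : ℝ}
    (ht : t ∈ Set.Ioo (1 / 2 : ℝ) (3 / 2)) : 0 < curvature a t := by
  have := abs_tsum_sub_zero_le (f := fun v : ℕ => a v * t ^ (v + 1) * ((v : ℝ) + 1) ^ 2) (u := 1)
    fun v => abs_coeff_mul_le ha (by linarith [ht.1]) (by linarith [ht.2]) v (by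
      rw [mul_one, abs_of_nonneg (by positivity)]
      exact cast_succ_sq_le_cube v)
  simp only [h0] at this
  have := (abs_le.1 this).1
  have := ht.1
  norm_num at *
  rw [curvature]
  linarith

lemma summable_phase {a : ℕ → ℝ} (ha : ∀ v, |a v| ≤ (1 / 100) ^ v) {t : ℝ}
    (ht0 : 0 ≤ t) (ht2 : t ≤ 2) (θ : ℝ) :
    Summable fun v : ℕ => ((a v * t ^ (v + 1) : ℝ) : ℂ) *
      (Complex.exp ((((v : ℝ) + 1) * θ : ℝ) * Complex.I) - 1) := by
  refine Summable.of_norm_bounded ((summable_coeff ha ht0 ht2).abs.mul_right 2) fun v => ?_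
  rw [norm_mul, Complex.norm_real, Real.norm_eq_abs]
  gcongr
  refine (norm_sub_le _ _).trans ?_
  rw [Complex.norm_exp_ofReal_mul_I]
  norm_num

lemma phase_re_le {a : ℕ → ℝ} (h0 : a 0 = 1) (ha : ∀ v, |a v| ≤ (1 / 100) ^ v) {t : ℝ}
    (ht : t ∈ Set.Ioo (1 / 2 : ℝ) (3 / 2)) {θ : ℝ} (hθ : |θ| ≤ Real.pi) :
    (phase a t θ).re ≤ -(1 / 50) * θ ^ 2 := by
  have ht0 : 0 ≤ t := by linarith [ht.1]
  have ht2 : t ≤ 2 := by linarith [ht.2]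
  have hre : (phase a t θ).re
      = -∑' v : ℕ, a v * t ^ (v + 1) * (1 - Real.cos (((v : ℝ) + 1) * θ)) := by
    rw [phase, Complex.sub_re, Complex.re_tsum (summable_phase ha ht0 ht2 θ), ← tsum_neg]
    simp only [Complex.mul_re, Complex.I_re, Complex.I_im, Complex.ofReal_re, Complex.ofReal_im,
      Complex.sub_re, Complex.one_re, Complex.exp_ofReal_mul_I_re]
    rw [mul_zero, zero_mul, sub_zero, sub_zero]
    congr 1; ext v; ring
  have hb := abs_tsum_sub_zero_le
    (f := fun v : ℕ => a v * t ^ (v + 1) * (1 - Real.cos (((v : ℝ) + 1) * θ)))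
    (u := 1 - Real.cos θ) fun v => abs_coeff_mul_le ha ht0 ht2 v (by
      have h1 := one_sub_cos_nat_mul_le (v + 1) θ
      push_cast at h1
      have h2 := Real.cos_le_one θ
      have h3 := Real.cos_le_one (((v : ℝ) + 1) * θ)
      rw [abs_of_nonneg (by linarith)]
      refine h1.trans ?_
      have := cast_succ_sq_le_cube v
      gcongr)
  simp only [h0, Nat.cast_zero, zero_add, pow_one, one_mul] at hb
  have hb := (abs_le.1 hb).1
  have hcos := Real.cos_le_one_sub_mul_cos_sq hθ
  have hpi : (1 / 5 : ℝ) ≤ 2 / Real.pi ^ 2 := by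
    rw [div_le_div_iff₀ (by norm_num) (by positivity)]
    nlinarith [Real.pi_lt_d2, Real.pi_pos]
  have hu : 1 / 5 * θ ^ 2 ≤ 1 - Real.cos θ := by
    have : 1 / 5 * θ ^ 2 ≤ 2 / Real.pi ^ 2 * θ ^ 2 := by gcongr
    linarith
  rw [hre]
  nlinarith [ht.1, sq_nonneg θ]

lemma norm_phase_add_le {a : ℕ → ℝ} (ha : ∀ v, |a v| ≤ (1 / 100) ^ v) {t : ℝ}
    (ht : t ∈ Set.Ioo (1 / 2 : ℝ) (3 / 2)) (hst : tDeriv a t = 1) (θ : ℝ) :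
    ‖phase a t θ + ((curvature a t * θ ^ 2 / 2 : ℝ) : ℂ)‖ ≤ 10 * |θ| ^ 3 := by
  have ht0 : 0 ≤ t := by linarith [ht.1]
  have ht2 : t ≤ 2 := by linarith [ht.2]
  have hc : ((curvature a t * θ ^ 2 / 2 : ℝ) : ℂ)
      = ∑' v : ℕ, ((a v * t ^ (v + 1) * ((v : ℝ) + 1) ^ 2 : ℝ) : ℂ) * ((θ : ℂ) ^ 2 / 2) := by
    rw [tsum_mul_right, ← Complex.ofReal_tsum, curvature]
    push_cast; ring
  have hsum1 : Summable fun v : ℕ =>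
      ((a v * t ^ (v + 1) * ((v : ℝ) + 1) ^ 2 : ℝ) : ℂ) * ((θ : ℂ) ^ 2 / 2) :=
    (Complex.hasSum_ofReal.2 (summable_coeff_mul_succ_sq ha ht0 ht2).hasSum).summable.mul_right _
  have hd : (θ : ℂ) * Complex.I
      = ∑' v : ℕ, ((a v * t ^ (v + 1) * ((v : ℝ) + 1) : ℝ) : ℂ) * ((θ : ℂ) * Complex.I) := by
    rw [tsum_mul_right, ← Complex.ofReal_tsum]
    change _ = ((tDeriv a t : ℝ) : ℂ) * _
    rw [hst]; simp
  have hsum2 : Summable fun v : ℕ =>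
      ((a v * t ^ (v + 1) * ((v : ℝ) + 1) : ℝ) : ℂ) * ((θ : ℂ) * Complex.I) :=
    (Complex.hasSum_ofReal.2 (summable_coeff_mul_succ ha ht0 ht2).hasSum).summable.mul_right _
  rw [phase, hc, hd, ← (summable_phase ha ht0 ht2 θ).tsum_sub hsum2,
    ← ((summable_phase ha ht0 ht2 θ).sub hsum2).tsum_add hsum1]
  refine (tsum_of_norm_bounded (hasSum_majorant.mul_right (4 * |θ| ^ 3)) fun v => ?_).trans ?_
  · have hx := norm_exp_mul_I_taylor_le (((v : ℝ) + 1) * θ)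
    have heq : ((a v * t ^ (v + 1) : ℝ) : ℂ) *
          (Complex.exp ((((v : ℝ) + 1) * θ : ℝ) * Complex.I) - 1)
        - ((a v * t ^ (v + 1) * ((v : ℝ) + 1) : ℝ) : ℂ) * ((θ : ℂ) * Complex.I)
        + ((a v * t ^ (v + 1) * ((v : ℝ) + 1) ^ 2 : ℝ) : ℂ) * ((θ : ℂ) ^ 2 / 2)
        = ((a v * t ^ (v + 1) : ℝ) : ℂ) *
          (Complex.exp ((((v : ℝ) + 1) * θ : ℝ) * Complex.I) - 1
            - (((v : ℝ) + 1) * θ : ℝ) * Complex.I + ((((v : ℝ) + 1) * θ : ℝ) : ℂ) ^ 2 / 2) := by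
      push_cast; ring
    rw [heq, norm_mul, Complex.norm_real, Real.norm_eq_abs]
    have h4 := abs_coeff_mul_le ha ht0 ht2 v (y := 4 * |((v : ℝ) + 1) * θ| ^ 3)
      (u := 4 * |θ| ^ 3) (by
        rw [abs_of_nonneg (by positivity), abs_mul, abs_of_nonneg (by positivity : (0 : ℝ) ≤ v + 1)]
        exact le_of_eq (by ring))
    rw [abs_mul, abs_of_nonneg (by positivity : 0 ≤ 4 * |((v : ℝ) + 1) * θ| ^ 3)] at h4
    refine le_trans ?_ h4
    gcongr
  · have : 0 ≤ |θ| ^ 3 := by positivity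
    linarith

/-- The polynomial perturbation of the exponent. -/
def perturb (c : ℕ → ℝ) (n : ℕ) (z : ℂ) : ℂ := ∑ v ∈ Finset.Icc 1 n, (c v : ℂ) * z ^ v

lemma norm_sum_Icc_le {f : ℕ → ℂ} {n : ℕ} {u : ℝ} (hu : 0 ≤ u)
    (hf : ∀ v ∈ Finset.Icc 1 n, ‖f v‖ ≤ 2 * (4 / 25) ^ v * u) :
    ‖∑ v ∈ Finset.Icc 1 n, f v‖ ≤ 3 * u := by
  calc _ ≤ ∑ v ∈ Finset.Icc 1 n, 2 * (4 / 25 : ℝ) ^ v * u := norm_sum_le_of_le _ hf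
    _ ≤ 50 / 21 * u :=
        sum_le_hasSum _ (fun v _ => by positivity) (hasSum_majorant.mul_right u)
    _ ≤ 3 * u := by linarith

lemma norm_perturb_le {c : ℕ → ℝ} {n : ℕ} (hc : ∀ v ∈ Finset.Icc 1 n, |c v| ≤ 2 * (1 / 100) ^ v)
    {z : ℂ} (hz : ‖z‖ ≤ 2) : ‖perturb c n z‖ ≤ 3 := by
  refine (norm_sum_Icc_le (u := 1) zero_le_one fun v hv => ?_).trans (by norm_num)
  rw [norm_mul, norm_pow, Complex.norm_real, Real.norm_eq_abs]
  calc |c v| * ‖z‖ ^ v ≤ 2 * (1 / 100) ^ v * 2 ^ v := by gcongr; exact hc v hv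
    _ = 2 * (2 / 100) ^ v := by rw [mul_assoc, ← mul_pow]; norm_num
    _ ≤ 2 * (4 / 25) ^ v := by gcongr <;> norm_num
    _ = _ := by ring

lemma norm_perturb_sub_le {c : ℕ → ℝ} {n : ℕ}
    (hc : ∀ v ∈ Finset.Icc 1 n, |c v| ≤ 2 * (1 / 100) ^ v)
    {t : ℝ} (ht0 : 0 ≤ t) (ht2 : t ≤ 2) (θ : ℝ) :
    ‖perturb c n (t * Complex.exp (θ * Complex.I)) - perturb c n t‖ ≤ 3 * |θ| := by
  rw [perturb, perturb, ← Finset.sum_sub_distrib]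
  refine norm_sum_Icc_le (abs_nonneg θ) fun v hv => ?_
  have h1 : (c v : ℂ) * (t * Complex.exp (θ * Complex.I)) ^ v - (c v : ℂ) * (t : ℂ) ^ v
      = (c v : ℂ) * (t : ℂ) ^ v * (Complex.exp (Complex.I * ((v * θ : ℝ) : ℂ)) - 1) := by
    rw [mul_pow, ← Complex.exp_nat_mul,
      show (v : ℂ) * (θ * Complex.I) = Complex.I * ((v * θ : ℝ) : ℂ) by push_cast; ring]
    ring
  have h2 := Real.norm_exp_I_mul_ofReal_sub_one_le (x := v * θ)
  rw [Real.norm_eq_abs, abs_mul, Nat.abs_cast] at h2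
  have h3 : (v : ℝ) ≤ 2 ^ v := by exact_mod_cast Nat.lt_two_pow_self.le
  rw [h1, norm_mul, norm_mul, norm_pow, Complex.norm_real, Complex.norm_real, Real.norm_eq_abs,
    Real.norm_of_nonneg ht0]
  calc |c v| * t ^ v * ‖Complex.exp (Complex.I * ((v * θ : ℝ) : ℂ)) - 1‖
      ≤ 2 * (1 / 100) ^ v * 2 ^ v * (2 ^ v * |θ|) := by
        gcongr
        · exact hc v hv
        · exact h2.trans (by gcongr)
    _ = 2 * (1 / 100 * 2 * 2) ^ v * |θ| := by rw [mul_pow, mul_pow]; ring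
    _ ≤ 2 * (4 / 25) ^ v * |θ| := by gcongr; norm_num

lemma perturb_ofReal (c : ℕ → ℝ) (n : ℕ) (t : ℝ) :
    perturb c n t = ((∑ v ∈ Finset.Icc 1 n, c v * t ^ v : ℝ) : ℂ) := by
  simp [perturb]

/-- The perturbed generating function `exp(n Σ a_v z^{v+1}) exp(perturbation)`. -/
def genFun (a c : ℕ → ℝ) (n : ℕ) (z : ℂ) : ℂ :=
  Complex.exp ((n : ℂ) * ∑' v : ℕ, (a v : ℂ) * z ^ (v + 1)) * Complex.exp (perturb c n z)

lemma norm_coeff_mul_pow_le {a : ℕ → ℝ} (ha : ∀ v, |a v| ≤ (1 / 100) ^ v) {z : ℂ} (hz : ‖z‖ ≤ 2)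
    (v : ℕ) : ‖(a v : ℂ) * z ^ (v + 1)‖ ≤ 2 * (4 / 25) ^ v := by
  have := abs_coeff_mul_le ha (norm_nonneg z) hz v (y := 1) (u := 1) (by
    have := cast_succ_le_cube v
    have := (Nat.cast_nonneg v : (0 : ℝ) ≤ v)
    simp; linarith)
  simpa [abs_mul] using this

lemma differentiableOn_genFun {a : ℕ → ℝ} (ha : ∀ v, |a v| ≤ (1 / 100) ^ v) (c : ℕ → ℝ) (n : ℕ) :
    DifferentiableOn ℂ (genFun a c n) (Metric.ball 0 2) := by
  have h1 : DifferentiableOn ℂ (fun z : ℂ => ∑' v : ℕ, (a v : ℂ) * z ^ (v + 1))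
      (Metric.ball 0 2) := by
    refine Complex.differentiableOn_tsum_of_summable_norm hasSum_majorant.summable
      (fun v => by fun_prop) Metric.isOpen_ball fun v z hz => ?_
    exact norm_coeff_mul_pow_le ha (by simpa using (mem_ball_zero_iff.1 hz).le) v
  unfold genFun perturb
  fun_prop

/-- The integrand of the Cauchy formula, normalised by its value at the saddle point. -/
def saddleIntegrand (a c : ℕ → ℝ) (n : ℕ) (t θ : ℝ) : ℂ :=
  Complex.exp (n * phase a t θ + perturb c n (t * Complex.exp (θ * Complex.I)))

lemma genFun_circle {a : ℕ → ℝ} (ha : ∀ v, |a v| ≤ (1 / 100) ^ v) (c : ℕ → ℝ) (n : ℕ) {t : ℝ}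
    (ht0 : 0 ≤ t) (ht2 : t ≤ 2) (θ : ℝ) :
    genFun a c n (t * Complex.exp (θ * Complex.I))
      = Complex.exp (((n * ∑' v : ℕ, a v * t ^ (v + 1) : ℝ)) : ℂ) *
        Complex.exp (θ * Complex.I) ^ n * saddleIntegrand a c n t θ := by
  have hsum : ∑' v : ℕ, (a v : ℂ) * (t * Complex.exp (θ * Complex.I)) ^ (v + 1)
      = ((∑' v : ℕ, a v * t ^ (v + 1) : ℝ) : ℂ) + (phase a t θ + θ * Complex.I) := by
    rw [phase, sub_add_cancel, Complex.ofReal_tsum, ← (Complex.hasSum_ofReal.2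
      (summable_coeff ha ht0 ht2).hasSum).summable.tsum_add (summable_phase ha ht0 ht2 θ)]
    congr 1; ext v
    rw [mul_pow, ← Complex.exp_nat_mul]
    push_cast
    rw [← mul_assoc ((v : ℂ) + 1)]
    ring
  rw [genFun, saddleIntegrand, hsum, ← Complex.exp_nat_mul, ← Complex.exp_add, ← Complex.exp_add,
    ← Complex.exp_add]
  congr 1
  push_cast
  ring

lemma continuous_phase {a : ℕ → ℝ} (ha : ∀ v, |a v| ≤ (1 / 100) ^ v) {t : ℝ}
    (ht0 : 0 ≤ t) (ht2 : t ≤ 2) : Continuous (phase a t) := by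
  unfold phase
  refine Continuous.sub ?_ (by fun_prop)
  refine continuous_tsum (fun v => by fun_prop) ((summable_coeff ha ht0 ht2).abs.mul_right 2)
    fun v θ => ?_
  rw [norm_mul, Complex.norm_real, Real.norm_eq_abs]
  gcongr
  refine (norm_sub_le _ _).trans ?_
  rw [Complex.norm_exp_ofReal_mul_I]
  norm_num

lemma continuous_saddleIntegrand {a : ℕ → ℝ} (ha : ∀ v, |a v| ≤ (1 / 100) ^ v) (c : ℕ → ℝ) (n : ℕ)
    {t : ℝ} (ht0 : 0 ≤ t) (ht2 : t ≤ 2) : Continuous (saddleIntegrand a c n t) := by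
  have := continuous_phase ha ht0 ht2
  unfold saddleIntegrand perturb
  fun_prop

/-- Cauchy's formula on the circle of radius `t`. -/
lemma coeff_genFun_eq {a : ℕ → ℝ} (ha : ∀ v, |a v| ≤ (1 / 100) ^ v) (c : ℕ → ℝ) (n : ℕ) {t : ℝ}
    (ht : t ∈ Set.Ioo (1 / 2 : ℝ) (3 / 2)) :
    iteratedDeriv n (genFun a c n) 0 / n.factorial
      = (((t ^ n)⁻¹ * Real.exp (n * ∑' v : ℕ, a v * t ^ (v + 1)) * (2 * Real.pi)⁻¹ : ℝ) : ℂ) *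
        ∫ θ in (-Real.pi)..Real.pi, saddleIntegrand a c n t θ := by
  have ht0 : 0 < t := by linarith [ht.1]
  have ht2 : t ≤ 2 := by linarith [ht.2]
  have hd : DifferentiableOn ℂ (genFun a c n) (Metric.closedBall 0 t) :=
    (differentiableOn_genFun ha c n).mono (Metric.closedBall_subset_ball (by linarith [ht.2]))
  have hC := hd.circleIntegral_one_div_sub_center_pow_smul ht0 n
  set E := Real.exp (n * ∑' v : ℕ, a v * t ^ (v + 1)) with hE
  have hcirc : (∮ z in C(0, t), (1 / (z - 0) ^ (n + 1)) • genFun a c n z)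
      = ∫ θ in (0 : ℝ)..2 * Real.pi,
        Complex.I * (((t ^ n)⁻¹ * E : ℝ) : ℂ) * saddleIntegrand a c n t θ := by
    rw [circleIntegral]
    refine intervalIntegral.integral_congr fun θ _ => ?_
    have hne : Complex.exp (θ * Complex.I) ≠ 0 := Complex.exp_ne_zero _
    have hne' : (t : ℂ) ≠ 0 := by exact_mod_cast ht0.ne'
    simp only [deriv_circleMap, circleMap_zero, sub_zero, smul_eq_mul]
    rw [genFun_circle ha c n ht0.le ht2 θ]
    push_cast [hE]
    rw [mul_pow, pow_succ (t : ℂ), pow_succ (Complex.exp _)]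
    field_simp
  have hper : Function.Periodic (saddleIntegrand a c n t) (2 * Real.pi) := by
    intro θ
    have h1 := genFun_circle ha c n ht0.le ht2 θ
    have h2 := genFun_circle ha c n ht0.le ht2 (θ + 2 * Real.pi)
    have h3 : Complex.exp (((θ + 2 * Real.pi : ℝ) : ℂ) * Complex.I)
        = Complex.exp (θ * Complex.I) := by
      push_cast
      rw [add_mul, Complex.exp_add, Complex.exp_two_pi_mul_I, mul_one]
    rw [h3, h1] at h2
    exact (mul_left_cancel₀ (mul_ne_zero (Complex.exp_ne_zero _)
      (pow_ne_zero _ (Complex.exp_ne_zero _))) h2).symm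
  have hshift := hper.intervalIntegral_add_eq 0 (-Real.pi)
  rw [zero_add, show -Real.pi + 2 * Real.pi = Real.pi by ring] at hshift
  rw [hcirc, intervalIntegral.integral_const_mul, hshift, smul_eq_mul] at hC
  have hpi : (2 * Real.pi * Complex.I : ℂ) ≠ 0 := Complex.two_pi_I_ne_zero
  have hI : Complex.I ≠ 0 := Complex.I_ne_zero
  have hpi' : (Real.pi : ℂ) ≠ 0 := by exact_mod_cast Real.pi_ne_zero
  have hfac : (n.factorial : ℂ) ≠ 0 := by exact_mod_cast n.factorial_ne_zero
  generalize (∫ θ in (-Real.pi)..Real.pi, saddleIntegrand a c n t θ) = J at *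
  generalize iteratedDeriv n (genFun a c n) 0 = W at *
  have : Complex.I * (2 * Real.pi * (W / n.factorial))
      = Complex.I * ((((t ^ n)⁻¹ * E : ℝ) : ℂ) * J) := by
    linear_combination -hC
  have := mul_left_cancel₀ hI this
  push_cast at this ⊢
  field_simp at this ⊢
  linear_combination this

lemma norm_saddleIntegrand_le {a c : ℕ → ℝ} (h0 : a 0 = 1) (ha : ∀ v, |a v| ≤ (1 / 100) ^ v)
    {n : ℕ} (hc : ∀ v ∈ Finset.Icc 1 n, |c v| ≤ 2 * (1 / 100) ^ v) {t : ℝ}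
    (ht : t ∈ Set.Ioo (1 / 2 : ℝ) (3 / 2)) {θ : ℝ} (hθ : |θ| ≤ Real.pi) :
    ‖saddleIntegrand a c n t θ‖ ≤ Real.exp 3 * Real.exp (-(1 / 50) * (n * θ ^ 2)) := by
  rw [saddleIntegrand, Complex.norm_exp, ← Real.exp_add]
  gcongr
  rw [Complex.add_re, ← Complex.ofReal_natCast, Complex.re_ofReal_mul]
  have h1 := phase_re_le h0 ha ht hθ
  have h2 : (perturb c n (t * Complex.exp (θ * Complex.I))).re ≤ 3 := by
    refine (Complex.re_le_norm _).trans (norm_perturb_le hc ?_)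
    rw [norm_mul, Complex.norm_exp_ofReal_mul_I, Complex.norm_real, Real.norm_of_nonneg] <;>
      linarith [ht.1, ht.2]
  have h3 : (n : ℝ) * (phase a t θ).re ≤ n * (-(1 / 50) * θ ^ 2) := by gcongr
  linarith

lemma tendsto_mul_phase {a : ℕ → ℝ} (ha : ∀ v, |a v| ≤ (1 / 100) ^ v) {t : ℝ}
    (ht : t ∈ Set.Ioo (1 / 2 : ℝ) (3 / 2)) (hst : tDeriv a t = 1) (s : ℝ) :
    Tendsto (fun n : ℕ => (n : ℂ) * phase a t (s / √n)) atTop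
      (nhds ((-(curvature a t / 2) * s ^ 2 : ℝ) : ℂ)) := by
  rw [tendsto_iff_norm_sub_tendsto_zero]
  have hlim : Tendsto (fun n : ℕ => 10 * |s| ^ 3 * (√(n : ℝ))⁻¹) atTop (nhds 0) := by
    rw [← mul_zero (10 * |s| ^ 3)]
    exact (tendsto_inv_atTop_zero.comp
      (Real.tendsto_sqrt_atTop.comp tendsto_natCast_atTop_atTop)).const_mul _
  refine squeeze_zero' (Eventually.of_forall fun n => norm_nonneg _) ?_ hlim
  filter_upwards [eventually_gt_atTop 0] with n hn
  have hn' : (0 : ℝ) < n := by exact_mod_cast hn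
  have hsq : √(n : ℝ) ^ 2 = n := Real.sq_sqrt hn'.le
  have hpos : 0 < √(n : ℝ) := Real.sqrt_pos.2 hn'
  have h := norm_phase_add_le ha ht hst (s / √n)
  have heq : (n : ℂ) * phase a t (s / √n) - ((-(curvature a t / 2) * s ^ 2 : ℝ) : ℂ)
      = ((n : ℝ) : ℂ) *
        (phase a t (s / √n) + ((curvature a t * (s / √n) ^ 2 / 2 : ℝ) : ℂ)) := by
    rw [mul_add, ← Complex.ofReal_mul, div_pow, hsq,
      show (n : ℝ) * (curvature a t * (s ^ 2 / n) / 2) = curvature a t / 2 * s ^ 2 by field_simp]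
    push_cast; ring
  rw [heq, norm_mul, Complex.norm_real, Real.norm_of_nonneg hn'.le]
  calc (n : ℝ) * _ ≤ n * (10 * |s / √n| ^ 3) := by gcongr
    _ = 10 * |s| ^ 3 * (√(n : ℝ))⁻¹ := by
        rw [abs_div, abs_of_pos hpos, ← hsq, Real.sqrt_sq hpos.le]
        field_simp

lemma sqrt_mul_integral_saddleIntegrand (a c : ℕ → ℝ) (t : ℝ) {n : ℕ} (hn : 0 < n) :
    (∫ θ in (-Real.pi)..Real.pi, saddleIntegrand a c n t θ)
      = (((√(n : ℝ))⁻¹ : ℝ) : ℂ) *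
        ∫ s : ℝ, (Set.Ioc (-Real.pi * √n) (Real.pi * √n)).indicator
          (fun s => saddleIntegrand a c n t (s / √n)) s := by
  have hpos : 0 < √(n : ℝ) := Real.sqrt_pos.2 (by exact_mod_cast hn)
  rw [integral_indicator measurableSet_Ioc, ← intervalIntegral.integral_of_le
    (mul_le_mul_of_nonneg_right (by linarith [Real.pi_pos]) hpos.le),
    intervalIntegral.integral_comp_div _ hpos.ne', mul_div_cancel_right₀ _ hpos.ne',
    mul_div_cancel_right₀ _ hpos.ne', Complex.real_smul, ← mul_assoc, ← Complex.ofReal_mul,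
    inv_mul_cancel₀ hpos.ne']
  simp

/-- Laplace asymptotics of the normalised Cauchy integral. -/
lemma tendsto_integral_saddle {a : ℕ → ℝ} {c : ℕ → ℕ → ℝ} (h0 : a 0 = 1)
    (ha : ∀ v, |a v| ≤ (1 / 100) ^ v)
    (hc : ∀ n, ∀ v ∈ Finset.Icc 1 n, |c n v| ≤ 2 * (1 / 100) ^ v) {t : ℝ}
    (ht : t ∈ Set.Ioo (1 / 2 : ℝ) (3 / 2)) (hst : tDeriv a t = 1) :
    Tendsto (fun n : ℕ =>
      (∫ s : ℝ, (Set.Ioc (-Real.pi * √n) (Real.pi * √n)).indicator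
          (fun s => saddleIntegrand a (c n) n t (s / √n)) s)
        - Complex.exp (perturb (c n) n t) *
          ((∫ s : ℝ, Real.exp (-(curvature a t / 2) * s ^ 2) : ℝ) : ℂ)) atTop (nhds 0) := by
  have ht0 : 0 ≤ t := by linarith [ht.1]
  have ht2 : t ≤ 2 := by linarith [ht.2]
  have hτ := curvature_pos h0 ha ht
  have hp : ∀ n, ‖Complex.exp (perturb (c n) n t)‖ ≤ Real.exp 3 := by
    intro n
    rw [Complex.norm_exp]
    gcongr
    refine (Complex.re_le_norm _).trans (norm_perturb_le (hc n) ?_)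
    rwa [Complex.norm_real, Real.norm_of_nonneg ht0]
  have hInt1 : Integrable fun s : ℝ => Real.exp 3 * Real.exp (-(1 / 50) * s ^ 2) :=
    (integrable_exp_neg_mul_sq (by norm_num)).const_mul _
  have hInt2 : Integrable fun s : ℝ => Real.exp (-(curvature a t / 2) * s ^ 2) :=
    integrable_exp_neg_mul_sq (by linarith)
  have hmeas : ∀ n : ℕ, AEStronglyMeasurable
      (fun s => (Set.Ioc (-Real.pi * √n) (Real.pi * √n)).indicator
          (fun s => saddleIntegrand a (c n) n t (s / √n)) s) volume := fun n =>
    (((continuous_saddleIntegrand ha (c n) n ht0 ht2).comp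
      (continuous_id.div_const _)).aestronglyMeasurable).indicator measurableSet_Ioc
  have hbound : ∀ (n : ℕ) (s : ℝ), ‖(Set.Ioc (-Real.pi * √n) (Real.pi * √n)).indicator
          (fun s => saddleIntegrand a (c n) n t (s / √n)) s‖
        ≤ Real.exp 3 * Real.exp (-(1 / 50) * s ^ 2) := by
    intro n s
    by_cases hs : s ∈ Set.Ioc (-Real.pi * √n) (Real.pi * √n)
    · have hpos : 0 < √(n : ℝ) := by
        by_contra h
        have h' : √(n : ℝ) = 0 := le_antisymm (not_lt.1 h) (Real.sqrt_nonneg _)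
        simp [h'] at hs
      rw [Set.indicator_of_mem hs]
      refine (norm_saddleIntegrand_le h0 ha (hc n) ht ?_).trans (le_of_eq ?_)
      · rw [abs_le]
        constructor
        · rw [le_div_iff₀ hpos]; exact hs.1.le
        · rw [div_le_iff₀ hpos]; exact hs.2
      · rw [div_pow, Real.sq_sqrt (Nat.cast_nonneg n), mul_div_cancel₀]
        exact (Real.sqrt_pos.1 hpos).ne'
    · rw [Set.indicator_of_notMem hs, norm_zero]
      positivity
  have hInt3 : ∀ n : ℕ, Integrable fun s => (Set.Ioc (-Real.pi * √n) (Real.pi * √n)).indicator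
          (fun s => saddleIntegrand a (c n) n t (s / √n)) s := fun n =>
    hInt1.mono' (hmeas n) (Eventually.of_forall (hbound n))
  have hInt2' : Integrable
      (fun s : ℝ => ((Real.exp (-(curvature a t / 2) * s ^ 2) : ℝ) : ℂ)) := hInt2.ofReal
  have hsplit : ∀ n : ℕ, (∫ s : ℝ, (Set.Ioc (-Real.pi * √n) (Real.pi * √n)).indicator
          (fun s => saddleIntegrand a (c n) n t (s / √n)) s)
        - Complex.exp (perturb (c n) n t) *
          ((∫ s : ℝ, Real.exp (-(curvature a t / 2) * s ^ 2) : ℝ) : ℂ)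
      = ∫ s : ℝ, ((Set.Ioc (-Real.pi * √n) (Real.pi * √n)).indicator
          (fun s => saddleIntegrand a (c n) n t (s / √n)) s
        - Complex.exp (perturb (c n) n t) *
          ((Real.exp (-(curvature a t / 2) * s ^ 2) : ℝ) : ℂ)) := by
    intro n
    rw [integral_sub (hInt3 n) (hInt2'.const_mul (Complex.exp (perturb (c n) n t))),
      integral_const_mul, integral_complex_ofReal]
  simp_rw [hsplit]
  rw [show (0 : ℂ) = ∫ _ : ℝ, (0 : ℂ) by simp]
  refine tendsto_integral_of_dominated_convergence
    (fun s => Real.exp 3 * Real.exp (-(1 / 50) * s ^ 2)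
      + Real.exp 3 * Real.exp (-(curvature a t / 2) * s ^ 2)) ?_
    (hInt1.add (hInt2.const_mul _)) ?_ ?_
  · exact fun n => (hmeas n).sub (hInt2'.const_mul _).aestronglyMeasurable
  · refine fun n => Eventually.of_forall fun s => (norm_sub_le _ _).trans ?_
    gcongr
    · exact hbound n s
    · rw [norm_mul, Complex.norm_real, Real.norm_of_nonneg (Real.exp_nonneg _)]
      gcongr
      exact hp n
  · refine Eventually.of_forall fun s => ?_
    have hsqrt : Tendsto (fun n : ℕ => √(n : ℝ)) atTop atTop :=
      Real.tendsto_sqrt_atTop.comp tendsto_natCast_atTop_atTop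
    have hpert : Tendsto (fun n : ℕ =>
        perturb (c n) n (t * Complex.exp (((s / √n : ℝ) : ℂ) * Complex.I))
          - perturb (c n) n t) atTop (nhds 0) := by
      rw [tendsto_zero_iff_norm_tendsto_zero]
      refine squeeze_zero (fun n => norm_nonneg _)
        (fun n => norm_perturb_sub_le (hc n) ht0 ht2 (s / √n)) ?_
      have : Tendsto (fun n : ℕ => s / √(n : ℝ)) atTop (nhds 0) := hsqrt.const_div_atTop s
      simpa using this.abs.const_mul 3
    have hX := (tendsto_mul_phase ha ht hst s).add hpert
    rw [add_zero] at hX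
    have hexp := (Complex.continuous_exp.tendsto _).comp hX
    have hdiff := hexp.sub_const (Complex.exp ((-(curvature a t / 2) * s ^ 2 : ℝ) : ℂ))
    rw [sub_self] at hdiff
    have hdiff' := (tendsto_zero_iff_norm_tendsto_zero.1 hdiff).const_mul (Real.exp 3)
    rw [mul_zero] at hdiff'
    rw [tendsto_zero_iff_norm_tendsto_zero]
    refine squeeze_zero' (Eventually.of_forall fun n => norm_nonneg _) ?_ hdiff'
    filter_upwards [hsqrt.eventually_gt_atTop |s|] with n hn
    have hmem : s ∈ Set.Ioc (-Real.pi * √n) (Real.pi * √n) := by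
      have h1 := abs_lt.1 hn
      have h2 : √(n : ℝ) ≤ Real.pi * √n := by
        nlinarith [Real.sqrt_nonneg (n : ℝ), Real.pi_gt_three]
      constructor
      · linarith
      · linarith
    rw [Set.indicator_of_mem hmem, saddleIntegrand]
    have : Complex.exp (n * phase a t (s / √n)
          + perturb (c n) n (t * Complex.exp (((s / √n : ℝ) : ℂ) * Complex.I)))
        - Complex.exp (perturb (c n) n t) *
          ((Real.exp (-(curvature a t / 2) * s ^ 2) : ℝ) : ℂ)
        = Complex.exp (perturb (c n) n t) * (Complex.exp (n * phase a t (s / √n)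
          + (perturb (c n) n (t * Complex.exp (((s / √n : ℝ) : ℂ) * Complex.I))
            - perturb (c n) n t))
          - Complex.exp ((-(curvature a t / 2) * s ^ 2 : ℝ) : ℂ)) := by
      rw [mul_sub, ← Complex.exp_add, ← Complex.ofReal_exp]
      congr 2
      ring
    rw [this, norm_mul]
    exact mul_le_mul_of_nonneg_right (hp n) (norm_nonneg _)

/-- Exponential growth rate of the `n`-th coefficient of the perturbed generating function. -/
lemma tendsto_log_coeff {a : ℕ → ℝ} {c : ℕ → ℕ → ℝ} (h0 : a 0 = 1)
    (ha : ∀ v, |a v| ≤ (1 / 100) ^ v)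
    (hc : ∀ n, ∀ v ∈ Finset.Icc 1 n, |c n v| ≤ 2 * (1 / 100) ^ v) {t : ℝ}
    (ht : t ∈ Set.Ioo (1 / 2 : ℝ) (3 / 2)) (hst : tDeriv a t = 1) :
    Tendsto (fun n : ℕ =>
      Real.log (iteratedDeriv n (genFun a (c n) n) 0 / n.factorial : ℂ).re / n) atTop
      (nhds (-Real.log t + ∑' v : ℕ, a v * t ^ (v + 1))) := by
  have ht0 : 0 < t := by linarith [ht.1]
  have ht2 : t ≤ 2 := by linarith [ht.2]
  have hτ := curvature_pos h0 ha ht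
  set J : ℝ := ∫ s : ℝ, Real.exp (-(curvature a t / 2) * s ^ 2) with hJ
  have hJpos : 0 < J := by
    rw [hJ, integral_gaussian]
    exact Real.sqrt_pos.2 (div_pos Real.pi_pos (by linarith))
  set R : ℕ → ℝ := fun n => (∫ s : ℝ, (Set.Ioc (-Real.pi * √n) (Real.pi * √n)).indicator
          (fun s => saddleIntegrand a (c n) n t (s / √n)) s).re with hR
  set p : ℕ → ℝ := fun n => ∑ v ∈ Finset.Icc 1 n, c n v * t ^ v with hp
  have hpb : ∀ n, |p n| ≤ 3 := by
    intro n
    have := norm_perturb_le (hc n) (z := t) (by rwa [Complex.norm_real, Real.norm_of_nonneg ht0.le])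
    rwa [perturb_ofReal, Complex.norm_real] at this
  have hRlim : Tendsto (fun n => R n - Real.exp (p n) * J) atTop (nhds 0) := by
    have h := (Complex.continuous_re.tendsto _).comp (tendsto_integral_saddle h0 ha hc ht hst)
    refine h.congr fun n => ?_
    rw [Function.comp_apply, Complex.sub_re, perturb_ofReal, ← Complex.ofReal_exp,
      ← Complex.ofReal_mul, Complex.ofReal_re]
  have hlow : 0 < Real.exp (-3) * J / 2 := by positivity
  have hRbd : ∀ᶠ n in atTop, Real.exp (-3) * J / 2 ≤ R n ∧
      R n ≤ Real.exp 3 * J + Real.exp (-3) * J / 2 := by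
    filter_upwards [(Metric.tendsto_nhds.1 hRlim) _ hlow] with n hn
    rw [Real.dist_eq, sub_zero] at hn
    have h1 := abs_lt.1 hn
    have h2 : Real.exp (-3) * J ≤ Real.exp (p n) * J := by
      gcongr; exact (abs_le.1 (hpb n)).1
    have h3 : Real.exp (p n) * J ≤ Real.exp 3 * J := by
      gcongr; exact (abs_le.1 (hpb n)).2
    constructor <;> linarith
  have hcast : Tendsto (fun n : ℕ => (n : ℝ)) atTop atTop := tendsto_natCast_atTop_atTop
  have hlogR : Tendsto (fun n : ℕ => Real.log (R n) / n) atTop (nhds 0) := by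
    have h1 := hcast.const_div_atTop (Real.log (Real.exp (-3) * J / 2))
    have h2 := hcast.const_div_atTop (Real.log (Real.exp 3 * J + Real.exp (-3) * J / 2))
    refine tendsto_of_tendsto_of_tendsto_of_le_of_le' h1 h2 ?_ ?_
    · filter_upwards [hRbd] with n hn
      have := Real.log_le_log hlow hn.1
      gcongr
    · filter_upwards [hRbd] with n hn
      have := Real.log_le_log (hlow.trans_le hn.1) hn.2
      gcongr
  have hlogn : Tendsto (fun n : ℕ => Real.log (2 * Real.pi) / n + 1 / 2 * (Real.log n / n)) atTop
      (nhds 0) := by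
    have h1 := hcast.const_div_atTop (Real.log (2 * Real.pi))
    have h2 : Tendsto (fun x : ℝ => Real.log x / x) atTop (nhds 0) := by
      simpa using Real.tendsto_pow_log_div_mul_add_atTop 1 0 1 one_ne_zero
    have h3 := (h2.comp hcast).const_mul (1 / 2)
    simpa using h1.add h3
  have hmain := (tendsto_const_nhds (x := -Real.log t + ∑' v : ℕ, a v * t ^ (v + 1))
    (f := (atTop : Filter ℕ))).add (hlogR.sub hlogn)
  rw [sub_zero, add_zero] at hmain
  refine hmain.congr' ?_
  filter_upwards [hRbd, eventually_gt_atTop 0] with n hn hn0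
  have hn' : (0 : ℝ) < n := by exact_mod_cast hn0
  have hRpos : 0 < R n := hlow.trans_le hn.1
  have hspos : 0 < √(n : ℝ) := Real.sqrt_pos.2 hn'
  rw [coeff_genFun_eq ha (c n) n ht, Complex.re_ofReal_mul,
    sqrt_mul_integral_saddleIntegrand a (c n) t hn0, Complex.re_ofReal_mul]
  change _ = Real.log (_ * (_ * R n)) / _
  have hP : 0 < 2 * Real.pi := by positivity
  generalize 2 * Real.pi = P at *
  rw [Real.log_mul (by positivity) (by positivity), Real.log_mul (by positivity) (by positivity),
    Real.log_mul (by positivity) (by positivity), Real.log_mul (by positivity) (by positivity),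
    Real.log_inv, Real.log_inv, Real.log_inv, Real.log_exp, Real.log_pow,
    Real.log_sqrt hn'.le]
  field_simp
  ring

/-- The number of indices at which the sequence `f` takes the value `e`. -/
def mult {α : Type*} {m : ℕ} (f : Fin m → α) (e : α) : ℕ :=
  (Finset.univ.filter fun i => f i = e).card

lemma mult_cons {α : Type*} {m : ℕ} (a : α) (f : Fin m → α) (e : α) :
    mult (Fin.cons a f : Fin (m + 1) → α) e = (if a = e then 1 else 0) + mult f e := by
  simp only [mult, Finset.card_filter, Fin.sum_univ_succ, Fin.cons_zero, Fin.cons_succ]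

lemma mult_insertNth {α : Type*} {m : ℕ} (j : Fin (m + 1)) (a : α) (f : Fin m → α) (e : α) :
    mult (j.insertNth a f : Fin (m + 1) → α) e = (if a = e then 1 else 0) + mult f e := by
  simp only [mult, Finset.card_filter, Fin.sum_univ_succAbove _ j, Fin.insertNth_apply_same,
    Fin.insertNth_apply_succAbove]

/-- The sequences of length `m` in `S` in which every element occurs an even number of times. -/
def evenSeqs {α : Type*} [Fintype α] (S : Finset α) (m : ℕ) : Finset (Fin m → α) :=
  Finset.univ.filter fun f => (∀ i, f i ∈ S) ∧ ∀ e, Even (mult f e)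

lemma mem_evenSeqs {α : Type*} [Fintype α] {S : Finset α} {m : ℕ} {f : Fin m → α} :
    f ∈ evenSeqs S m ↔ (∀ i, f i ∈ S) ∧ ∀ e, Even (mult f e) := by
  simp [evenSeqs]

lemma card_evenSeqs_add_two_le {α : Type*} [Fintype α] (S : Finset α) (m : ℕ) :
    (evenSeqs S (m + 2)).card ≤ (m + 1) * S.card * (evenSeqs S m).card := by
  let F : Fin (m + 1) × α × (Fin m → α) → (Fin (m + 2) → α) :=
    fun p => Fin.cons p.2.1 (p.1.insertNth p.2.1 p.2.2 : Fin (m + 1) → α)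
  have hsub : evenSeqs S (m + 2) ⊆
      ((Finset.univ : Finset (Fin (m + 1))) ×ˢ S ×ˢ evenSeqs S m).image F := by
    intro f hf
    obtain ⟨hS, hev⟩ := mem_evenSeqs.1 hf
    have hcons : f = Fin.cons (f 0) (Fin.tail f) := (Fin.cons_self_tail f).symm
    have hex : ∃ j : Fin (m + 1), Fin.tail f j = f 0 := by
      by_contra! h
      have h0 : mult (Fin.tail f) (f 0) = 0 := by
        simpa [mult, Finset.filter_eq_empty_iff] using h
      have h1 := hev (f 0)
      rw [hcons, mult_cons] at h1
      simp [h0] at h1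
    obtain ⟨j, hj⟩ := hex
    have htail : Fin.tail f = j.insertNth (f 0) (j.removeNth (Fin.tail f)) := by
      rw [← hj, Fin.insertNth_self_removeNth]
    rw [Finset.mem_image]
    refine ⟨(j, f 0, j.removeNth (Fin.tail f)), ?_, ?_⟩
    · simp only [Finset.mem_product, Finset.mem_univ, true_and, mem_evenSeqs]
      refine ⟨hS 0, fun i => hS _, fun e => ?_⟩
      have h1 := hev e
      rw [hcons, mult_cons, htail, mult_insertNth, ← add_assoc] at h1
      split_ifs at h1
      · exact (Nat.even_add.1 h1).1 (by decide)
      · simpa using h1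
    · simp only [F]
      rw [← htail, ← hcons]
  calc (evenSeqs S (m + 2)).card ≤ _ := Finset.card_le_card hsub
    _ ≤ _ := Finset.card_image_le
    _ = (m + 1) * S.card * (evenSeqs S m).card := by
      simp [Finset.card_product, mul_assoc]

lemma card_evenSeqs_mul_le {α : Type*} [Fintype α] (S : Finset α) (k : ℕ) :
    (evenSeqs S (2 * k)).card * (2 ^ k * k.factorial) ≤ (2 * k).factorial * S.card ^ k := by
  induction k with
  | zero => simpa using (Finset.card_le_univ (evenSeqs S 0)).trans (by simp)
  | succ k ih =>
    calc (evenSeqs S (2 * k + 2)).card * (2 ^ (k + 1) * (k + 1).factorial)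
        ≤ ((2 * k + 1) * S.card * (evenSeqs S (2 * k)).card) *
          (2 ^ (k + 1) * (k + 1).factorial) :=
          Nat.mul_le_mul_right _ (card_evenSeqs_add_two_le S _)
      _ = (2 * k + 2) * (2 * k + 1) * S.card *
          ((evenSeqs S (2 * k)).card * (2 ^ k * k.factorial)) := by
          rw [Nat.factorial_succ]; ring
      _ ≤ (2 * k + 2) * (2 * k + 1) * S.card * ((2 * k).factorial * S.card ^ k) :=
          Nat.mul_le_mul_left _ ih
      _ = (2 * (k + 1)).factorial * S.card ^ (k + 1) := by
          rw [show 2 * (k + 1) = 2 * k + 1 + 1 by ring, Nat.factorial_succ, Nat.factorial_succ]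
          ring

lemma abs_signB {N : ℕ} (q : ℕ) (l : List (Finset (Fin N))) : |signB q l| = 1 := by
  unfold signB
  split_ifs <;> simp

lemma bMulti_eq {N : ℕ} (q : ℕ) (r : Finset (Fin N) → ℕ) (m : ℕ) :
    bMulti q r m = ∑ f : Fin m → Finset (Fin N),
      if (∀ e, mult f e = r e) then signB q (List.ofFn f) else 0 := by
  unfold bMulti
  refine Finset.sum_congr rfl fun f _ => if_congr (forall_congr' fun e => ?_) rfl rfl
  rw [mult]
  convert Iff.rfl

lemma sum_abs_bMulti_le {N q M : ℕ} (m : ℕ) (P : (Finset (Fin N) → ℕ) → Prop)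
    (hcard : ∀ r, P r → ∀ e, r e ≠ 0 → e.card = q) (heven : ∀ r, P r → ∀ e, Even (r e)) :
    ∑ r : Finset (Fin N) → Fin M,
      (if P (fun e => (r e : ℕ)) then |bMulti q (fun e => (r e : ℕ)) m| else 0)
      ≤ ((evenSeqs (Finset.powersetCard q (Finset.univ : Finset (Fin N))) m).card : ℝ) := by
  set S := Finset.powersetCard q (Finset.univ : Finset (Fin N))
  have hterm : ∀ r : Finset (Fin N) → Fin M,
      (if P (fun e => (r e : ℕ)) then |bMulti q (fun e => (r e : ℕ)) m| else 0)
      ≤ ∑ f ∈ evenSeqs S m, if (∀ e, mult f e = (r e : ℕ)) then (1 : ℝ) else 0 := by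
    intro r
    split_ifs with hP
    · rw [bMulti_eq]
      refine (Finset.abs_sum_le_sum_abs _ _).trans ?_
      rw [← Finset.sum_subset (Finset.subset_univ (evenSeqs S m))]
      · refine Finset.sum_le_sum fun f _ => ?_
        split_ifs
        · rw [abs_signB]
        · simp
      · intro f _ hf
        rw [if_neg, abs_zero]
        intro h
        refine hf (mem_evenSeqs.2 ⟨fun i => ?_, fun e => ?_⟩)
        · refine Finset.mem_powersetCard.2 ⟨Finset.subset_univ _, hcard _ hP _ ?_⟩
          refine (h (f i)).symm.trans_ne ?_
          exact (Finset.card_pos.2 ⟨i, by simp⟩).ne'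
        · exact (h e).symm ▸ heven _ hP e
    · exact Finset.sum_nonneg fun f _ => by split_ifs <;> simp
  refine (Finset.sum_le_sum fun r _ => hterm r).trans ?_
  rw [Finset.sum_comm]
  refine (Finset.sum_le_card_nsmul _ _ 1 fun f _ => ?_).trans (by simp)
  rw [Finset.sum_boole, Nat.cast_le_one]
  refine Finset.card_le_one.2 fun r hr s hs => ?_
  funext e
  exact Fin.ext (((Finset.mem_filter.1 hr).2 e).symm.trans ((Finset.mem_filter.1 hs).2 e))

lemma sq_coupling (q n : ℕ) (hq : Even q) (β : ℝ) :
    (β * ((2 : ℝ) ^ (q / 2))⁻¹ * sigma q n) ^ 2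
      = 2 * ((q - 1).factorial * β ^ 2 / 2 ^ (q + 1)) / (n : ℝ) ^ (q - 1) := by
  have h2 : ((2 : ℝ) ^ (q / 2)) ^ 2 = 2 ^ q := by
    rw [← pow_mul, Nat.div_mul_cancel hq.two_dvd]
  rw [mul_pow, mul_pow, inv_pow, h2, sigma, Real.sq_sqrt (by positivity), pow_succ]
  field_simp
  ring

lemma pow_div_factorial_le_three_pow (v k : ℕ) : (v : ℝ) ^ k / k.factorial ≤ 3 ^ v := by
  refine (Real.pow_div_factorial_le_exp (v : ℝ) v.cast_nonneg k).trans ?_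
  rw [← Real.exp_one_pow]
  gcongr
  exact (Real.exp_one_lt_d9.trans (by norm_num)).le

lemma abs_muVD_le {q n v : ℕ} (hq : Even q) (hq2 : 2 ≤ q) (hv : 1 ≤ v) (hn : 1 ≤ n) (Δ : ℕ)
    {β δ : ℝ} (hδ : 0 < δ)
    (hβ : ((q - 1).factorial * β ^ 2 / 2 ^ (q + 1) : ℝ) ≤ δ ^ (q - 1)) :
    |muVD q n β v Δ| ≤ 9 ^ v * δ ^ (v - 1 + Δ) * ((v : ℝ) / n) ^ Δ := by
  have hn0 : (0 : ℝ) < n := by exact_mod_cast hn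
  have hv0 : (0 : ℝ) < v := by exact_mod_cast hv
  by_cases hex : ∃ k, (q - 1) * k = v - 1 + Δ
  swap
  · have : muVD q n β v Δ = 0 := by
      unfold muVD
      rw [Finset.sum_eq_zero, mul_zero]
      intro r _
      rw [if_neg]
      rintro ⟨-, hev, -, hsum⟩
      obtain ⟨k, hk⟩ : Even (∑ e, (r e : ℕ)) := Finset.even_sum _ fun e _ => hev e
      refine hex ⟨k, ?_⟩
      rw [hk, ← two_mul, mul_left_comm] at hsum
      omega
    rw [this, abs_zero]
    positivity
  obtain ⟨k, hk⟩ := hex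
  set B : ℝ := (q - 1).factorial * β ^ 2 / 2 ^ (q + 1) with hB
  have hB0 : 0 ≤ B := by positivity
  set x : ℝ := β * ((2 : ℝ) ^ (q / 2))⁻¹ * sigma q n with hx
  set S := Finset.powersetCard q (Finset.univ : Finset (Fin v))
  have hScard : (S.card : ℝ) ≤ (v : ℝ) ^ q := by
    rw [Finset.card_powersetCard, Finset.card_univ, Fintype.card_fin]
    exact_mod_cast Nat.choose_le_pow v q
  have hsum : |∑ r : Finset (Fin v) → Fin (2 * (v - 1 + Δ) + 1),
      if IsMultiHG q v Δ (fun e => (r e : ℕ)) then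
        x ^ (∑ e, (r e : ℕ)) *
          bMulti q (fun e => (r e : ℕ)) (∑ e, (r e : ℕ)) / (∑ e, (r e : ℕ)).factorial
      else 0| ≤ (x ^ 2) ^ k / (2 * k).factorial * (evenSeqs S (2 * k)).card := by
    refine (Finset.abs_sum_le_sum_abs _ _).trans ?_
    refine le_trans ?_ (mul_le_mul_of_nonneg_left
      (sum_abs_bMulti_le (M := 2 * (v - 1 + Δ) + 1) (2 * k) (IsMultiHG q v Δ)
        (fun r hr => hr.1) (fun r hr => hr.2.1)) (by positivity))
    rw [Finset.mul_sum]
    refine Finset.sum_le_sum fun r _ => ?_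
    split_ifs with h
    · have hm : ∑ e, (r e : ℕ) = 2 * k := by
        refine Nat.eq_of_mul_eq_mul_left (show 0 < q - 1 by omega) (h.2.2.2.trans ?_)
        rw [← hk, mul_left_comm]
      rw [hm, abs_div, abs_mul, pow_mul, abs_of_nonneg (by positivity : 0 ≤ (x ^ 2) ^ k),
        Nat.abs_cast, div_mul_eq_mul_div]
    · simp
  have hcount : ((evenSeqs S (2 * k)).card : ℝ) / (2 * k).factorial
      ≤ ((v : ℝ) ^ q) ^ k / (2 ^ k * k.factorial) := by
    rw [div_le_div_iff₀ (by positivity) (by positivity)]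
    have := card_evenSeqs_mul_le S k
    calc ((evenSeqs S (2 * k)).card : ℝ) * (2 ^ k * k.factorial)
        ≤ (2 * k).factorial * (S.card : ℝ) ^ k := by exact_mod_cast this
      _ ≤ (2 * k).factorial * ((v : ℝ) ^ q) ^ k := by gcongr
      _ = _ := mul_comm _ _
  have hvq : ((v : ℝ) ^ q) ^ k = v ^ k * (v ^ (v - 1) * v ^ Δ) := by
    rw [← pow_add, ← hk, ← pow_mul, ← pow_add]
    congr 1
    obtain ⟨p, rfl⟩ : ∃ p, q = p + 1 := ⟨q - 1, by omega⟩
    simp only [Nat.add_sub_cancel]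
    ring
  have hnpow : (n : ℝ) ^ (v - 1) / ((n : ℝ) ^ (q - 1)) ^ k = ((n : ℝ) ^ Δ)⁻¹ := by
    rw [← pow_mul, hk, pow_add]
    field_simp
  have hvv : (v : ℝ) ^ (v - 1) / v.factorial ≤ 3 ^ v := by
    refine le_trans ?_ (pow_div_factorial_le_three_pow v v)
    gcongr
    · exact_mod_cast hv
    · omega
  unfold muVD
  rw [abs_mul, abs_of_nonneg (by positivity : (0 : ℝ) ≤ (n : ℝ) ^ (v - 1) / v.factorial)]
  calc (n : ℝ) ^ (v - 1) / v.factorial * _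
      ≤ (n : ℝ) ^ (v - 1) / v.factorial *
        ((x ^ 2) ^ k / (2 * k).factorial * (evenSeqs S (2 * k)).card) := by gcongr
    _ = (n : ℝ) ^ (v - 1) / v.factorial *
        ((x ^ 2) ^ k * ((evenSeqs S (2 * k)).card / (2 * k).factorial)) := by ring
    _ ≤ (n : ℝ) ^ (v - 1) / v.factorial *
        ((x ^ 2) ^ k * (((v : ℝ) ^ q) ^ k / (2 ^ k * k.factorial))) := by gcongr
    _ = ((n : ℝ) ^ (v - 1) / ((n : ℝ) ^ (q - 1)) ^ k) * B ^ k * ((v : ℝ) ^ k / k.factorial) *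
        ((v : ℝ) ^ (v - 1) / v.factorial) * (v : ℝ) ^ Δ := by
        rw [hx, sq_coupling q n hq, ← hB, hvq, div_pow, mul_pow]
        field_simp
    _ ≤ ((n : ℝ) ^ Δ)⁻¹ * (δ ^ (q - 1)) ^ k * 3 ^ v * 3 ^ v * (v : ℝ) ^ Δ := by
        rw [hnpow]
        gcongr
        exact pow_div_factorial_le_three_pow v k
    _ = 9 ^ v * δ ^ (v - 1 + Δ) * ((v : ℝ) / n) ^ Δ := by
        rw [← pow_mul, hk, div_pow, show (9 : ℝ) = 3 * 3 by norm_num, mul_pow]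
        field_simp

/-- The union of the stars spanning the hyperedges of `E`, centred at the least vertex of each. -/
def starGraph {N : ℕ} (E : Finset (Finset (Fin N))) : SimpleGraph (Fin N) :=
  SimpleGraph.fromEdgeSet
    {p | ∃ e ∈ E, ∃ h : e.Nonempty, ∃ x ∈ e.erase (e.min' h), p = s(e.min' h, x)}

lemma reachable_starGraph {N : ℕ} {E : Finset (Finset (Fin N))} {a b : Fin N}
    (h : edgeRel E a b) : (starGraph E).Reachable a b := by
  obtain ⟨e, he, ha, hb⟩ := h
  have hne : e.Nonempty := ⟨a, ha⟩
  have key : ∀ x ∈ e, (starGraph E).Reachable (e.min' hne) x := by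
    intro x hx
    by_cases hxm : x = e.min' hne
    · rw [hxm]
    · refine SimpleGraph.Adj.reachable ?_
      rw [starGraph, SimpleGraph.fromEdgeSet_adj]
      exact ⟨⟨e, he, hne, x, Finset.mem_erase.2 ⟨hxm, hx⟩, rfl⟩, fun h => hxm h.symm⟩
  exact (key a ha).symm.trans (key b hb)

lemma card_le_of_hgConnected {q N : ℕ} {E : Finset (Finset (Fin N))} (hN : 1 ≤ N)
    (hq : ∀ e ∈ E, e.card = q) (hE : HGConnected E) : N - 1 ≤ (q - 1) * E.card := by
  have : Nonempty (Fin N) := ⟨⟨0, hN⟩⟩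
  have hconn : (starGraph E).Connected := by
    refine ⟨fun a b => ?_⟩
    induction hE a b with
    | refl => rfl
    | tail _ h ih => exact ih.trans (reachable_starGraph h)
  have h1 := hconn.card_vert_le_card_edgeSet_add_one
  rw [Nat.card_eq_fintype_card, Fintype.card_fin] at h1
  let F : Finset (Sym2 (Fin N)) := E.biUnion fun e =>
    if h : e.Nonempty then (e.erase (e.min' h)).image fun x => s(e.min' h, x) else ∅
  have hsub : (starGraph E).edgeSet ⊆ F := by
    intro p hp
    rw [starGraph, SimpleGraph.edgeSet_fromEdgeSet] at hp
    obtain ⟨⟨e, he, hne, x, hx, rfl⟩, -⟩ := hp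
    refine Finset.mem_coe.2 (Finset.mem_biUnion.2 ⟨e, he, ?_⟩)
    rw [dif_pos hne]
    exact Finset.mem_image.2 ⟨x, hx, rfl⟩
  have h2 : Nat.card (starGraph E).edgeSet ≤ F.card := by
    have := Set.ncard_le_ncard hsub (Finset.finite_toSet F)
    rwa [Set.ncard_coe_finset] at this
  have h3 : F.card ≤ E.card * (q - 1) := by
    refine Finset.card_biUnion_le_card_mul _ _ _ fun e he => ?_
    split_ifs with h
    · refine Finset.card_image_le.trans ?_
      rw [Finset.card_erase_of_mem (Finset.min'_mem _ _), hq e he]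
    · simp
  rw [mul_comm]
  omega

lemma isMultiHG_two_mul {q v : ℕ} {E : Finset (Finset (Fin v))} (hE : IsHypertree q v E) :
    IsMultiHG q v 0 (fun e => if e ∈ E then 2 else 0) := by
  refine ⟨fun e he => hE.1 e ?_, fun e => ?_, fun a b => ?_, ?_⟩
  · by_contra h
    exact he (if_neg h)
  · beta_reduce
    split_ifs <;> simp
  · refine Relation.ReflTransGen.mono (fun x y => ?_) _ _ (hE.2.1 a b)
    rintro ⟨e, he, h⟩
    exact ⟨e, by simp [he], h⟩
  · rw [Finset.sum_ite_mem, Finset.univ_inter, Finset.sum_const, smul_eq_mul, ← mul_assoc,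
      hE.2.2, mul_comm, add_zero]

lemma IsMultiHG.eq_two_mul {q v : ℕ} (hv : 1 ≤ v) (hq2 : 2 ≤ q) {r : Finset (Fin v) → ℕ}
    (h : IsMultiHG q v 0 r) :
    IsHypertree q v (Finset.univ.filter fun e => r e ≠ 0) ∧
      r = fun e => if e ∈ Finset.univ.filter (fun e => r e ≠ 0) then 2 else 0 := by
  obtain ⟨hcard, hev, hconn, hsum⟩ := h
  set E := Finset.univ.filter fun e => r e ≠ 0 with hEdef
  have hE1 : ∀ e ∈ E, e.card = q := fun e he => hcard e (Finset.mem_filter.1 he).2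
  have hE2 : HGConnected E := by
    intro a b
    refine Relation.ReflTransGen.mono (fun x y => ?_) _ _ (hconn a b)
    rintro ⟨e, he, h⟩
    exact ⟨e, by simp [hEdef, he], h⟩
  have hlow := card_le_of_hgConnected hv hE1 hE2
  have hr2 : ∀ e ∈ E, 2 ≤ r e := by
    intro e he
    obtain ⟨k, hk⟩ := hev e
    have := (Finset.mem_filter.1 he).2
    omega
  have hsumE : ∑ e ∈ E, r e = ∑ e, r e := Finset.sum_filter_ne_zero _
  have hle : ∑ e ∈ E, r e ≤ ∑ _e ∈ E, 2 := by
    rw [hsumE, Finset.sum_const, smul_eq_mul]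
    refine Nat.le_of_mul_le_mul_left (c := q - 1) ?_ (by omega)
    rw [hsum]
    calc 2 * (v - 1 + 0) ≤ 2 * ((q - 1) * E.card) := by omega
      _ = _ := by ring
  have heq : ∀ e ∈ E, 2 = r e :=
    (Finset.sum_eq_sum_iff_of_le hr2).1 (le_antisymm (Finset.sum_le_sum hr2) hle)
  refine ⟨⟨hE1, hE2, ?_⟩, ?_⟩
  · have : ∑ e, r e = E.card * 2 := by
      rw [← hsumE, ← Finset.sum_congr rfl heq, Finset.sum_const, smul_eq_mul]
    rw [this, ← mul_assoc] at hsum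
    omega
  · funext e
    split_ifs with he
    · exact (heq e he).symm
    · simpa [hEdef] using he

lemma sum_isMultiHG_zero {q v : ℕ} (hv : 1 ≤ v) (hq2 : 2 ≤ q)
    (F : (Finset (Fin v) → ℕ) → ℝ) :
    ∑ r : Finset (Fin v) → Fin (2 * (v - 1 + 0) + 1),
      (if IsMultiHG q v 0 (fun e => (r e : ℕ)) then F (fun e => (r e : ℕ)) else 0)
      = ∑ E ∈ trees q v, F (fun e => if e ∈ E then 2 else 0) := by
  rw [← Finset.sum_filter]
  refine Finset.sum_nbij (fun r => Finset.univ.filter fun e => (r e : ℕ) ≠ 0) ?_ ?_ ?_ ?_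
  · intro r hr
    exact Finset.mem_filter.2
      ⟨Finset.mem_univ _, (IsMultiHG.eq_two_mul hv hq2 (Finset.mem_filter.1 hr).2).1⟩
  · intro r hr s hs hrs
    have h1 := (IsMultiHG.eq_two_mul hv hq2 (Finset.mem_filter.1 hr).2).2
    have h2 := (IsMultiHG.eq_two_mul hv hq2 (Finset.mem_filter.1 hs).2).2
    funext e
    refine Fin.ext ((congrFun h1 e).trans (Eq.trans ?_ (congrFun h2 e).symm))
    exact if_congr (Finset.ext_iff.1 hrs e) rfl rfl
  · intro E hE
    have hE' : IsHypertree q v E := (Finset.mem_filter.1 hE).2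
    have hlt : ∀ e, (if e ∈ E then 2 else 0) < 2 * (v - 1 + 0) + 1 := by
      intro e
      split_ifs with he
      · have h1 := hE'.2.2
        have h2 : 0 < (q - 1) * E.card :=
          Nat.mul_pos (by omega) (Finset.card_pos.2 ⟨e, he⟩)
        omega
      · omega
    refine ⟨fun e => ⟨_, hlt e⟩, ?_, ?_⟩
    · refine Finset.mem_coe.2 (Finset.mem_filter.2 ⟨Finset.mem_univ _, isMultiHG_two_mul hE'⟩)
    · ext e
      simp
  · intro r hr
    exact congrArg F (IsMultiHG.eq_two_mul hv hq2 (Finset.mem_filter.1 hr).2).2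

lemma psi_mul_self {N : ℕ} (i : Fin N) : psi i * psi i = (1 / 2 : ℂ) • (1 : Cliff N) := by
  rw [psi, CliffordAlgebra.ι_sq_scalar, Algebra.algebraMap_eq_smul_one]
  congr 1
  simp [Qf, QuadraticMap.weightedSumSquares_apply, Pi.single_apply]

lemma psi_mul_psi {N : ℕ} {i j : Fin N} (h : i ≠ j) : psi i * psi j = -(psi j * psi i) := by
  rw [eq_neg_iff_add_eq_zero, psi, psi, CliffordAlgebra.ι_mul_ι_add_swap]
  have : QuadraticMap.polar (Qf N) (Pi.single i 1) (Pi.single j 1) = 0 := by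
    simp only [QuadraticMap.polar, Qf, QuadraticMap.weightedSumSquares_apply, Pi.add_apply,
      ← Finset.sum_sub_distrib]
    refine Finset.sum_eq_zero fun k _ => ?_
    by_cases hk : k = i
    · subst hk
      simp [h]
    · simp [Pi.single_apply, hk]
  rw [this, map_zero]

lemma psi_mul_prod {N : ℕ} (i : Fin N) (L : List (Fin N)) :
    psi i * (L.map psi).prod
      = ((-1 : ℂ) ^ (L.length + L.count i)) • ((L.map psi).prod * psi i) := by
  induction L with
  | nil => simp
  | cons j L ih =>
    rw [List.map_cons, List.prod_cons, ← mul_assoc, List.length_cons]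
    by_cases h : i = j
    · subst h
      rw [mul_assoc, ih, List.count_cons_self, mul_smul_comm, ← mul_assoc (psi i),
        ih]
      congr 1
      ring
    · rw [psi_mul_psi h, neg_mul, mul_assoc, ih, List.count_cons_of_ne (Ne.symm h),
        mul_smul_comm, mul_assoc, ← neg_smul]
      congr 1
      ring

lemma prod_mul_prod {N : ℕ} (L M : List (Fin N)) :
    (L.map psi).prod * (M.map psi).prod
      = ((-1 : ℂ) ^ (L.length * M.length + (L.map fun i => M.count i).sum)) •
        ((M.map psi).prod * (L.map psi).prod) := by
  induction L with
  | nil => simp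
  | cons i L ih =>
    rw [List.map_cons, List.prod_cons, mul_assoc, ih, mul_smul_comm, ← mul_assoc, psi_mul_prod,
      smul_mul_assoc, smul_smul, mul_assoc, List.map_cons, List.sum_cons, List.length_cons]
    congr 1
    ring

lemma prod_mul_self {N : ℕ} (L : List (Fin N)) (h : L.Nodup) :
    (L.map psi).prod * (L.map psi).prod
      = ((-1 : ℂ) ^ (L.length.choose 2) * ((2 : ℂ) ^ L.length)⁻¹) • (1 : Cliff N) := by
  induction L with
  | nil => simp
  | cons i L ih =>
    obtain ⟨hi, hL⟩ := List.nodup_cons.1 h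
    have hcomm := psi_mul_prod i L
    rw [List.count_eq_zero_of_not_mem hi, add_zero] at hcomm
    have hcomm' : (L.map psi).prod * psi i
        = ((-1 : ℂ) ^ L.length) • (psi i * (L.map psi).prod) := by
      rw [hcomm, smul_smul, ← pow_add, ← two_mul, pow_mul, neg_one_sq, one_pow, one_smul]
    rw [List.map_cons, List.prod_cons, mul_assoc, ← mul_assoc (L.map psi).prod, hcomm',
      smul_mul_assoc, mul_smul_comm, mul_assoc, ih hL, ← mul_assoc, psi_mul_self,
      smul_mul_smul_comm, one_mul, smul_smul, List.length_cons,
      Nat.choose_succ_succ' L.length 1, Nat.choose_one_right, pow_add, pow_succ]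
    congr 1
    rw [mul_inv]
    ring

lemma sum_count_sort {N : ℕ} (I J : Finset (Fin N)) :
    ((I.sort (· ≤ ·)).map fun i => (J.sort (· ≤ ·)).count i).sum = (I ∩ J).card := by
  have h : ∀ i, (J.sort (· ≤ ·)).count i = if i ∈ J then 1 else 0 := by
    intro i
    rw [List.Nodup.count (Finset.sort_nodup _ _)]
    simp
  simp_rw [h]
  rw [← List.sum_toFinset _ (Finset.sort_nodup _ _), Finset.sort_toFinset, Finset.sum_boole,
    ← Finset.filter_mem_eq_inter]
  rfl

/-- The sign in `psiSet I * psiSet J = ± psiSet J * psiSet I`. -/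
def commSign {N : ℕ} (I J : Finset (Fin N)) : ℝ := (-1) ^ (I ∩ J).card

lemma psiSet_mul_psiSet {N q : ℕ} (hq : Even q) {I : Finset (Fin N)} (hI : I.card = q)
    (J : Finset (Fin N)) :
    psiSet q I * psiSet q J = (commSign I J : ℂ) • (psiSet q J * psiSet q I) := by
  simp only [psiSet, smul_mul_smul_comm]
  rw [prod_mul_prod, sum_count_sort, Finset.length_sort, hI, pow_add, pow_mul, hq.neg_one_pow,
    one_pow, one_mul, smul_comm, commSign]
  norm_num

lemma psiSet_mul_self {N q : ℕ} (hq : Even q) {I : Finset (Fin N)} (hI : I.card = q) :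
    psiSet q I * psiSet q I = (((2 : ℂ) ^ q)⁻¹) • (1 : Cliff N) := by
  simp only [psiSet, smul_mul_smul_comm]
  rw [prod_mul_self _ (Finset.sort_nodup _ _), Finset.length_sort, hI, smul_smul]
  congr 1
  obtain ⟨p, rfl⟩ := hq
  rw [← mul_assoc, ← mul_pow, Complex.I_mul_I, ← two_mul, Nat.mul_div_cancel_left _ two_pos,
    Nat.choose_two_right, mul_assoc 2 p, Nat.mul_div_cancel_left _ two_pos, ← pow_add]
  rw [Even.neg_one_pow, one_mul]
  rcases p with _ | p
  · simp
  · rw [show 2 * (p + 1) - 1 = 2 * p + 1 by omega]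
    exact ⟨(p + 1) * (p + 1), by ring⟩

/-- The hyperedge carrying a given chord endpoint. -/
def lab {α : Type*} : α ⊕ α → α := Sum.elim id id

/-- The chord attached to `e` by the endpoint positions `u`. -/
def chord {α : Type*} (u : α ⊕ α → ℝ) (e : α) : ℝ × ℝ :=
  (min (u (Sum.inl e)) (u (Sum.inr e)), max (u (Sum.inl e)) (u (Sum.inr e)))

lemma chord_lab {α : Type*} (u : α ⊕ α → ℝ) {p : α ⊕ α} (h : u p < u p.swap) :
    chord u (lab p) = (u p, u p.swap) := by
  rcases p with e | e
  · exact Prod.ext (min_eq_left h.le) (max_eq_right h.le)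
  · exact Prod.ext (min_eq_right h.le) (max_eq_left h.le)

lemma eq_or_eq_swap_of_lab_eq {α : Type*} {p r : α ⊕ α} (h : lab r = lab p) :
    r = p ∨ r = p.swap := by
  rcases p with p | p <;> rcases r with r | r <;> simp_all [lab]

lemma lab_swap {α : Type*} (p : α ⊕ α) : lab p.swap = lab p := by
  rcases p with p | p <;> rfl

lemma K_chord {a b c d : ℝ} (hac : a < c) (had : a < d) (hcb : c ≠ b) (hdb : d ≠ b) :
    K (a, b) (min c d, max c d)
      = (if c < b then -1 else 1) * (if d < b then -1 else 1) := by
  have hm : ¬ min c d < a := not_lt.2 (le_min hac.le had.le)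
  simp only [K, lt_min_iff, hac, had, hm, lt_max_iff, min_lt_iff, false_and, or_false, true_and]
  rcases lt_or_gt_of_ne hcb with h1 | h1 <;> rcases lt_or_gt_of_ne hdb with h2 | h2 <;>
    simp [h1, h2, h1.not_gt, h2.not_gt]

lemma K_eq_one_or (x y : ℝ × ℝ) : K x y = 1 ∨ K x y = -1 := by
  unfold K
  split_ifs <;> simp

lemma BE_eq_one_or {N : ℕ} (E : Finset (Finset (Fin N))) (X : Finset (Fin N) → ℝ × ℝ) :
    BE E X = 1 ∨ BE E X = -1 := by
  unfold BE
  refine Finset.prod_induction _ (fun x : ℝ => x = 1 ∨ x = -1) ?_ (Or.inl rfl) ?_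
  · rintro a b (rfl | rfl) (rfl | rfl) <;> simp
  · intro p _
    induction p with
    | _ a b =>
      simp only [pairSign, Sym2.lift_mk]
      split_ifs
      · exact K_eq_one_or _ _
      · exact Or.inl rfl

lemma BE_insert {N : ℕ} {E : Finset (Finset (Fin N))} {e : Finset (Fin N)} (he : e ∉ E)
    (X : Finset (Fin N) → ℝ × ℝ) :
    BE (insert e E) X = (∏ e' ∈ E, pairSign X s(e, e')) * BE E X := by
  have hset : (insert e E).sym2.filter (fun p => ¬ p.IsDiag)
      = (E.image fun e' => s(e, e')) ∪ E.sym2.filter (fun p => ¬ p.IsDiag) := by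
    ext p
    induction p with
    | _ a b =>
      simp only [Finset.mem_filter, Finset.mk_mem_sym2_iff, Finset.mem_insert, Sym2.mk_isDiag_iff,
        Finset.mem_union, Finset.mem_image, Sym2.eq_iff]
      grind
  have hdisj : Disjoint (E.image fun e' => s(e, e')) (E.sym2.filter (fun p => ¬ p.IsDiag)) := by
    rw [Finset.disjoint_left]
    intro p hp hp'
    obtain ⟨e', -, rfl⟩ := Finset.mem_image.1 hp
    exact he (Finset.mk_mem_sym2_iff.1 (Finset.mem_filter.1 hp').1).1
  unfold BE
  rw [hset, Finset.prod_union hdisj, Finset.prod_image]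
  intro a _ b _ hab
  exact Sym2.congr_right.1 hab

lemma psiSet_mul_list_prod {N q : ℕ} (hq : Even q) {e : Finset (Fin N)} (he : e.card = q)
    (l : List (Finset (Fin N))) :
    psiSet q e * (l.map (psiSet q)).prod
      = (((l.map (commSign e)).prod : ℝ) : ℂ) • ((l.map (psiSet q)).prod * psiSet q e) := by
  induction l with
  | nil => simp
  | cons a l ih =>
    rw [List.map_cons, List.prod_cons, ← mul_assoc, psiSet_mul_psiSet hq he, smul_mul_assoc,
      mul_assoc, ih, mul_smul_comm, smul_smul, List.map_cons, List.prod_cons, Complex.ofReal_mul,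
      mul_assoc]

lemma prod_commSign_eq {N : ℕ} {E : Finset (Finset (Fin N))} {u : Finset (Fin N) ⊕ Finset (Fin N) → ℝ}
    {p : Finset (Fin N) ⊕ Finset (Fin N)} (hp : u p < u p.swap)
    {l : List (Finset (Fin N) ⊕ Finset (Fin N))} (hl : l.Nodup) (hE : ∀ a ∈ l, lab a ∈ E)
    (hlt : ∀ a, lab a ∈ E → u p < u a ∧ u a ≠ u p.swap ∧ (a ∈ l ↔ u a < u p.swap)) :
    (l.map fun a => commSign (lab p) (lab a)).prod
      = ∏ e' ∈ E, pairSign (chord u) s(lab p, e') := by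
  rw [← List.prod_toFinset _ hl,
    ← Finset.prod_fiberwise_of_maps_to (fun a ha => hE a (List.mem_toFinset.1 ha))]
  refine Finset.prod_congr rfl fun e' he' => ?_
  obtain ⟨h1, h2, h3⟩ := hlt (Sum.inl e') he'
  obtain ⟨h4, h5, h6⟩ := hlt (Sum.inr e') he'
  have hset : l.toFinset.filter (fun a => lab a = e')
      = ({Sum.inl e', Sum.inr e'} : Finset _).filter (· ∈ l) := by
    ext a
    rw [Finset.mem_filter, Finset.mem_filter, List.mem_toFinset, Finset.mem_insert,
      Finset.mem_singleton, and_comm]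
    refine and_congr_left' ?_
    rcases a with a | a <;> simp [lab]
  rw [hset, Finset.prod_filter, Finset.prod_pair (by simp)]
  simp only [h3, h6, pairSign, Sym2.lift_mk, chord_lab u hp]
  rw [show chord u e' = (min (u (Sum.inl e')) (u (Sum.inr e')),
    max (u (Sum.inl e')) (u (Sum.inr e'))) from rfl, K_chord h1 h4 h2 h5]
  simp only [lab, commSign, Sum.elim_inl, Sum.elim_inr, id]
  split_ifs with ha hb hc <;> first | rfl | skip
  all_goals simp_all [Odd.neg_one_pow]

lemma prod_psiSet_eq {N q : ℕ} (hq : Even q) (u : Finset (Fin N) ⊕ Finset (Fin N) → ℝ) (k : ℕ) :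
    ∀ (E : Finset (Finset (Fin N))), E.card = k → (∀ e ∈ E, e.card = q) →
    ∀ l : List (Finset (Fin N) ⊕ Finset (Fin N)), l.Pairwise (fun a b => u a < u b) →
    (∀ p, p ∈ l ↔ lab p ∈ E) →
    (l.map fun p => psiSet q (lab p)).prod
      = ((BE E (chord u) : ℂ) * (((2 : ℂ) ^ q)⁻¹) ^ k) • (1 : Cliff N) := by
  induction k with
  | zero =>
    intro E hk _ l _ hmem
    rw [Finset.card_eq_zero] at hk
    subst hk
    have : l = [] := List.eq_nil_iff_forall_not_mem.2 fun p hp => by simpa using (hmem p).1 hp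
    subst this
    simp [BE]
  | succ k ih =>
    intro E hk hq' l hl hmem
    rcases l with _ | ⟨p, l⟩
    · obtain ⟨e, he⟩ : E.Nonempty := Finset.card_pos.1 (by omega)
      simpa using (hmem (Sum.inl e)).2 he
    have hpE : lab p ∈ E := (hmem p).1 List.mem_cons_self
    have hsw : p.swap ∈ l := by
      have h1 := (hmem p.swap).2 (by rwa [lab_swap])
      rcases List.mem_cons.1 h1 with h2 | h2
      · rcases p with p | p <;> simp at h2
      · exact h2
    obtain ⟨l₁, l₂, rfl⟩ := List.append_of_mem hsw
    obtain ⟨hp, hl'⟩ := List.pairwise_cons.1 hl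
    obtain ⟨hl1, hl2, hl12⟩ := List.pairwise_append.1 hl'
    obtain ⟨hsl2, hl2'⟩ := List.pairwise_cons.1 hl2
    have hl1s : ∀ a ∈ l₁, u a < u p.swap := fun a ha => hl12 a ha _ List.mem_cons_self
    have hps := hp _ hsw
    have hmem' : ∀ a, a ∈ l₁ ++ l₂ ↔ lab a ∈ E.erase (lab p) := by
      intro a
      rw [Finset.mem_erase, ← hmem a]
      constructor
      · intro ha
        have ha' : u p < u a ∧ u a ≠ u p.swap := by
          rcases List.mem_append.1 ha with h | h
          · exact ⟨hp a (by simp [h]), (hl1s a h).ne⟩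
          · exact ⟨hp a (by simp [h]), (hsl2 a h).ne'⟩
        refine ⟨fun h => ?_, ?_⟩
        · rcases eq_or_eq_swap_of_lab_eq h with rfl | rfl
          · exact lt_irrefl _ ha'.1
          · exact ha'.2 rfl
        · simp only [List.mem_append] at ha
          simp only [List.mem_cons, List.mem_append]
          tauto
      · rintro ⟨hne, ha⟩
        have h1 : a ≠ p := fun h => hne (h ▸ rfl)
        have h2 : a ≠ p.swap := fun h => hne (h ▸ lab_swap p)
        simp only [List.mem_cons, List.mem_append] at ha ⊢
        tauto
    have hIH := ih (E.erase (lab p)) (by rw [Finset.card_erase_of_mem hpE]; omega)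
      (fun e he => hq' e (Finset.mem_of_mem_erase he)) (l₁ ++ l₂)
      (hl'.sublist (List.Sublist.append_left (List.sublist_cons_self _ _) _)) hmem'
    have hcs := prod_commSign_eq (E := E.erase (lab p)) hps (l := l₁)
      (hl1.imp fun h => ne_of_apply_ne u h.ne) (fun a ha => (hmem' a).1 (by simp [ha]))
      (fun a ha => by
        rcases List.mem_append.1 ((hmem' a).2 ha) with h | h
        · exact ⟨hp a (by simp [h]), (hl1s a h).ne, iff_of_true h (hl1s a h)⟩
        · refine ⟨hp a (by simp [h]), (hsl2 a h).ne', iff_of_false (fun h' => ?_) (hsl2 a h).not_gt⟩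
          exact ((hl1s a h').trans (hsl2 a h)).false)
    have hBE := BE_insert (Finset.notMem_erase (lab p) E) (chord u)
    rw [Finset.insert_erase hpE] at hBE
    have hmove := psiSet_mul_list_prod hq (hq' _ hpE) (l₁.map lab)
    rw [List.map_map, List.map_map] at hmove
    rw [List.map_append, List.prod_append] at hIH
    have hcs' : (List.map (commSign (lab p) ∘ lab) l₁).prod = _ := hcs
    rw [hcs'] at hmove
    have hmove' : psiSet q (lab p) * (l₁.map fun p => psiSet q (lab p)).prod
      = _ • ((l₁.map fun p => psiSet q (lab p)).prod * psiSet q (lab p)) := hmove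
    rw [List.map_cons, List.prod_cons, List.map_append, List.prod_append, List.map_cons,
      List.prod_cons, lab_swap, ← mul_assoc, hmove', smul_mul_assoc, mul_assoc,
      ← mul_assoc (psiSet q (lab p)), psiSet_mul_self hq (hq' _ hpE), smul_mul_assoc, one_mul,
      mul_smul_comm, hIH, smul_smul, smul_smul, hBE, Complex.ofReal_mul]
    congr 1
    ring

lemma signB_eq {N q : ℕ} (hq : Even q) (u : Finset (Fin N) ⊕ Finset (Fin N) → ℝ)
    {E : Finset (Finset (Fin N))} (hE : ∀ e ∈ E, e.card = q)
    {l : List (Finset (Fin N) ⊕ Finset (Fin N))} (hl : l.Pairwise (fun a b => u a < u b))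
    (hmem : ∀ p, p ∈ l ↔ lab p ∈ E) (hlen : l.length = 2 * E.card) :
    signB q (l.map lab) = BE E (chord u) := by
  have h := prod_psiSet_eq hq u _ E rfl hE l hl hmem
  have hpow : ((2 : ℂ) ^ (q * l.length / 2))⁻¹ = (((2 : ℂ) ^ q)⁻¹) ^ E.card := by
    rw [hlen, inv_pow, ← pow_mul, show q * (2 * E.card) = 2 * (q * E.card) by ring,
      Nat.mul_div_cancel_left _ two_pos]
  unfold signB
  rw [List.length_map, hpow, List.map_map]
  have h' : (l.map (psiSet q ∘ lab)).prod = _ := h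
  rw [h']
  rcases BE_eq_one_or E (chord u) with hB | hB
  · simp [hB]
  · rw [hB, if_neg]
    intro heq
    have hinv : Invertible (2 : ℂ) := invertibleOfNonzero two_ne_zero
    have hc : ((((2 : ℂ) ^ q)⁻¹) ^ E.card) ≠ 0 :=
      pow_ne_zero _ (inv_ne_zero (pow_ne_zero _ two_ne_zero))
    rw [← sub_eq_zero, ← sub_smul, smul_eq_zero] at heq
    rcases heq with h0 | h0
    · apply hc
      push_cast at h0
      linear_combination (-1 / 2 : ℂ) * h0
    · exact one_ne_zero h0

lemma card_equiv_comp_eq {α P ι : Type*} [Fintype α] [Fintype P] [Fintype ι] {g : P → α}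
    {f : ι → α} (h : ∀ e, Nat.card {p // g p = e} = Nat.card {i // f i = e}) :
    Nat.card {τ : P ≃ ι // g ∘ τ.symm = f} = ∏ e, (Nat.card {i // f i = e}).factorial := by
  let τ₀ : P ≃ ι := Equiv.ofFiberEquiv fun e => Classical.choice (Finite.card_eq.1 (h e))
  have hτ₀ : ∀ p, f (τ₀ p) = g p := Equiv.ofFiberEquiv_map _
  have hstab := DomMulAct.stabilizer_card f
  simp only [← Nat.card_eq_fintype_card] at hstab
  rw [← hstab]
  refine Nat.card_congr
    { toFun := fun τ => ⟨τ₀.symm.trans τ.1, ?_⟩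
      invFun := fun σ => ⟨τ₀.trans σ.1, ?_⟩
      left_inv := fun τ => ?_
      right_inv := fun σ => ?_ }
  · obtain ⟨τ, rfl⟩ := τ
    funext i
    simpa using (hτ₀ (τ₀.symm i)).symm
  · obtain ⟨σ, hσ⟩ := σ
    funext i
    have h1 := congrFun hσ (σ.symm i)
    have h2 := hτ₀ (τ₀.symm (σ.symm i))
    simp only [Function.comp_apply, Equiv.apply_symm_apply] at h1 h2
    simp [← h2, ← h1]
  · ext
    simp
  · ext
    simp

/-- The endpoints of the chords attached to the hyperedges of `E`. -/
abbrev Ends {α : Type*} (E : Finset α) : Type _ := {p : α ⊕ α // lab p ∈ E}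

lemma card_ends {α : Type*} [Fintype α] (E : Finset α) : Nat.card (Ends E) = 2 * E.card := by
  rw [Nat.card_eq_fintype_card, Fintype.card_subtype, two_mul, ← Finset.card_disjSum]
  congr 1
  ext p
  rw [Finset.mem_filter]
  rcases p with p | p <;> simp [lab]

lemma card_ends_lab_of_mem {α : Type*} {E : Finset α} {e : α} (he : e ∈ E) :
    Nat.card {p : Ends E // lab p.1 = e} = 2 := by
  rw [Nat.card_eq_two_iff]
  refine ⟨⟨⟨Sum.inl e, he⟩, rfl⟩, ⟨⟨Sum.inr e, he⟩, rfl⟩, fun h => ?_, ?_⟩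
  · exact Sum.inl_ne_inr (congrArg (fun x => x.1.1) h)
  · rw [Set.eq_univ_iff_forall]
    rintro ⟨⟨p | p, hp⟩, rfl⟩
    · exact Or.inl rfl
    · exact Or.inr rfl

lemma card_ends_lab_of_notMem {α : Type*} {E : Finset α} {e : α} (he : e ∉ E) :
    Nat.card {p : Ends E // lab p.1 = e} = 0 := by
  rw [Nat.card_eq_zero]
  refine Or.inl ⟨?_⟩
  rintro ⟨⟨p, hp⟩, rfl⟩
  exact he hp

/-- Extension by zero of positions of the chord endpoints of `E`. -/
def extendPos {α : Type*} {E : Finset α} (w : Ends E → ℝ) (p : α ⊕ α) : ℝ :=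
  if h : lab p ∈ E then w ⟨p, h⟩ else 0

lemma mult_eq_card {α : Type*} {m : ℕ} (f : Fin m → α) (e : α) :
    mult f e = Nat.card {i // f i = e} := by
  rw [Nat.card_eq_fintype_card, Fintype.card_subtype, mult]

lemma signB_ofFn_eq {N q k : ℕ} (hq : Even q) {E : Finset (Finset (Fin N))}
    (hE : ∀ e ∈ E, e.card = q) (hk : E.card = k) (τ : Ends E ≃ Fin (2 * k)) :
    signB q (List.ofFn fun i => lab (τ.symm i).1)
      = BE E (chord (extendPos fun p => ((τ p : ℕ) : ℝ))) := by
  rw [← signB_eq hq (extendPos fun p => ((τ p : ℕ) : ℝ)) hE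
    (l := List.ofFn fun i => (τ.symm i).1), List.map_ofFn]
  · rfl
  · rw [List.pairwise_ofFn]
    intro i j hij
    simp only [extendPos, (τ.symm i).2, (τ.symm j).2, dif_pos, Subtype.coe_eta,
      Equiv.apply_symm_apply]
    exact_mod_cast hij
  · intro p
    rw [List.mem_ofFn]
    constructor
    · rintro ⟨i, rfl⟩
      exact (τ.symm i).2
    · intro hp
      exact ⟨τ ⟨p, hp⟩, by simp⟩
  · rw [List.length_ofFn, hk]

lemma sum_signB_eq {N q k : ℕ} {E : Finset (Finset (Fin N))} (hk : E.card = k) :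
    ∑ τ : Ends E ≃ Fin (2 * k), signB q (List.ofFn fun i => lab (τ.symm i).1)
      = 2 ^ k * bMulti q (fun e => if e ∈ E then 2 else 0) (2 * k) := by
  rw [bMulti_eq, Finset.mul_sum,
    ← Finset.sum_fiberwise Finset.univ
      (fun τ : Ends E ≃ Fin (2 * k) => fun i => lab (τ.symm i).1)]
  refine Finset.sum_congr rfl fun f _ => ?_
  rw [Finset.sum_congr rfl (g := fun _ => signB q (List.ofFn f)) fun τ hτ => by
    rw [(Finset.mem_filter.1 hτ).2], Finset.sum_const, nsmul_eq_mul]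
  split_ifs with hf
  · have hcard := card_equiv_comp_eq (g := fun p : Ends E => lab p.1) (f := f) fun e => by
      rw [← mult_eq_card, hf]
      split_ifs with he
      · exact card_ends_lab_of_mem he
      · exact card_ends_lab_of_notMem he
    congr 1
    have h2 : (Finset.univ.filter fun τ : Ends E ≃ Fin (2 * k) =>
        (fun i => lab (τ.symm i).1) = f).card = 2 ^ k := by
      rw [Nat.card_eq_fintype_card, Fintype.card_subtype] at hcard
      refine Eq.trans ?_ (hcard.trans ?_)
      · congr 1
      · simp_rw [← mult_eq_card, hf]
        rw [← hk, ← Finset.prod_const, ← Finset.prod_subset (Finset.subset_univ E)]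
        · exact Finset.prod_congr rfl fun e he => by simp [he]
        · intro e _ he
          simp [he]
    exact_mod_cast h2
  · rw [Finset.filter_eq_empty_iff.2, Finset.card_empty, Nat.cast_zero, zero_mul, mul_zero]
    rintro τ - rfl
    refine hf fun e => ?_
    rw [mult_eq_card, Nat.card_congr
      (τ.symm.subtypeEquiv (p := fun i => lab (τ.symm i).1 = e) (q := fun p => lab p.1 = e)
        fun i => Iff.rfl)]
    split_ifs with he
    · exact card_ends_lab_of_mem he
    · exact card_ends_lab_of_notMem he

lemma measurable_K {Ω : Type*} [MeasurableSpace Ω] {f g : Ω → ℝ × ℝ} (hf : Measurable f)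
    (hg : Measurable g) : Measurable fun ω => K (f ω) (g ω) := by
  unfold K
  refine Measurable.ite (MeasurableSet.union ?_ ?_) measurable_const measurable_const
  · exact (measurableSet_lt hf.fst hg.fst).inter
      ((measurableSet_lt hg.fst hf.snd).inter (measurableSet_lt hf.snd hg.snd))
  · exact (measurableSet_lt hg.fst hf.fst).inter
      ((measurableSet_lt hf.fst hg.snd).inter (measurableSet_lt hg.snd hf.snd))

lemma measurable_BE {N : ℕ} (E : Finset (Finset (Fin N))) : Measurable (BE E) := by
  unfold BE
  refine Finset.measurable_fun_prod _ fun p _ => ?_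
  induction p with
  | _ a b =>
    simp only [pairSign, Sym2.lift_mk]
    split_ifs
    · exact measurable_K (measurable_pi_apply a) (measurable_pi_apply b)
    · exact measurable_const

lemma measurable_chord {α : Type*} : Measurable (chord : (α ⊕ α → ℝ) → α → ℝ × ℝ) := by
  unfold chord
  fun_prop

/-- The uniform law on `[0,1]`. -/
abbrev unif : Measure ℝ := volume.restrict (Set.Icc 0 1)

instance : IsProbabilityMeasure unif := ⟨by simp [unif]⟩

lemma nu_eq_map : nu = Measure.map (fun p : ℝ × ℝ => (min p.1 p.2, max p.1 p.2))
    (unif.prod unif) := by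
  rw [nu, Measure.prod_restrict, Measure.volume_eq_prod]

lemma measurable_minmax : Measurable fun p : ℝ × ℝ => (min p.1 p.2, max p.1 p.2) := by
  fun_prop

instance : IsProbabilityMeasure nu := by
  rw [nu_eq_map]
  exact Measure.isProbabilityMeasure_map measurable_minmax.aemeasurable

lemma map_chord_pi {α : Type*} [Fintype α] :
    Measure.map chord (Measure.pi fun _ : α ⊕ α => unif) = Measure.pi fun _ : α => nu := by
  have h1 := measurePreserving_sumPiEquivProdPi_symm (fun _ : α ⊕ α => unif)
  have h2 := measurePreserving_arrowProdEquivProdArrow ℝ ℝ α (fun _ => unif) (fun _ => unif)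
  have h3 := (h1.comp h2).map_eq
  rw [← h3, Measure.map_map measurable_chord (h1.comp h2).measurable]
  have : IsProbabilityMeasure
      (Measure.map (fun p : ℝ × ℝ => (min p.1 p.2, max p.1 p.2)) (unif.prod unif)) :=
    Measure.isProbabilityMeasure_map measurable_minmax.aemeasurable
  rw [nu_eq_map, ← Measure.pi_map_pi fun _ => measurable_minmax.aemeasurable]
  rfl

lemma bT_eq_integral {N : ℕ} (E : Finset (Finset (Fin N))) :
    bT E = ∫ u, BE E (chord u) ∂(Measure.pi fun _ => unif) := by
  rw [bT, ← map_chord_pi, integral_map measurable_chord.aemeasurable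
    (measurable_BE E).aestronglyMeasurable]

lemma ae_injective {ι : Type*} [Fintype ι] :
    ∀ᵐ u ∂(Measure.pi fun _ : ι => unif), Function.Injective u := by
  have hpair : ∀ p r : ι, p ≠ r → ∀ᵐ u : ι → ℝ ∂(Measure.pi fun _ : ι => unif), u p ≠ u r := by
    intro p r hpr
    unfold unif
    rw [← Measure.restrict_pi_pi]
    refine ae_restrict_of_ae ?_
    rw [← volume_pi, ae_iff]
    have := Measure.addHaar_submodule (volume : Measure (ι → ℝ))
      (LinearMap.ker (LinearMap.proj (R := ℝ) (φ := fun _ : ι => ℝ) p - LinearMap.proj (R := ℝ) (φ := fun _ : ι => ℝ) r : (ι → ℝ) →ₗ[ℝ] ℝ)) ?_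
    · convert this using 2
      ext u
      simp [sub_eq_zero]
    · intro htop
      have hmem : (Pi.single p 1 : ι → ℝ) ∈
          LinearMap.ker (LinearMap.proj (R := ℝ) (φ := fun _ : ι => ℝ) p - LinearMap.proj (R := ℝ) (φ := fun _ : ι => ℝ) r : (ι → ℝ) →ₗ[ℝ] ℝ) := by
        rw [htop]
        trivial
      simp [hpr.symm] at hmem
  have hall : ∀ᵐ u : ι → ℝ ∂(Measure.pi fun _ : ι => unif), ∀ p r, p ≠ r → u p ≠ u r :=
    ae_all_iff.2 fun p => ae_all_iff.2 fun r => by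
      by_cases hpr : p = r
      · exact ae_of_all _ fun u hne => absurd hpr hne
      · exact (hpair p r hpr).mono fun u hu _ => hu
  filter_upwards [hall] with u hu p r hur
  by_contra hne
  exact hu p r hne hur

lemma exists_equiv_lt_iff {P : Type*} [Fintype P] {m : ℕ} (hm : Fintype.card P = m) {w : P → ℝ}
    (hw : Function.Injective w) : ∃ τ : P ≃ Fin m, ∀ p r, τ p < τ r ↔ w p < w r := by
  let _ : LinearOrder P := LinearOrder.lift' w hw
  exact ⟨(Fintype.orderIsoFinOfCardEq P hm).symm.toEquiv,
    fun p r => (Fintype.orderIsoFinOfCardEq P hm).symm.lt_iff_lt⟩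

lemma BE_chord_congr {N : ℕ} {E : Finset (Finset (Fin N))}
    {u u' : Finset (Fin N) ⊕ Finset (Fin N) → ℝ}
    (h : ∀ p r : Ends E, u p < u r ↔ u' p < u' r) : BE E (chord u) = BE E (chord u') := by
  have h' : ∀ p r, lab p ∈ E → lab r ∈ E → (u p < u r ↔ u' p < u' r) :=
    fun p r hp hr => h ⟨p, hp⟩ ⟨r, hr⟩
  unfold BE
  refine Finset.prod_congr rfl fun p hp => ?_
  induction p with
  | _ a b =>
    obtain ⟨ha, hb⟩ := Finset.mk_mem_sym2_iff.1 (Finset.mem_filter.1 hp).1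
    simp only [pairSign, Sym2.lift_mk, K, chord, lt_min_iff, min_lt_iff, max_lt_iff, lt_max_iff]
    simp only [h' (Sum.inl a) (Sum.inl b) ha hb, h' (Sum.inl a) (Sum.inr b) ha hb,
      h' (Sum.inr a) (Sum.inl b) ha hb, h' (Sum.inr a) (Sum.inr b) ha hb,
      h' (Sum.inl b) (Sum.inl a) hb ha, h' (Sum.inl b) (Sum.inr a) hb ha,
      h' (Sum.inr b) (Sum.inl a) hb ha, h' (Sum.inr b) (Sum.inr a) hb ha]

lemma integrable_BE_chord {N : ℕ} (E : Finset (Finset (Fin N))) :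
    Integrable (fun u => BE E (chord u)) (Measure.pi fun _ => unif) := by
  refine Integrable.of_bound ((measurable_BE E).comp measurable_chord).aestronglyMeasurable 1
    (ae_of_all _ fun u => ?_)
  rcases BE_eq_one_or E (chord u) with h | h <;> simp [h]

lemma measurePreserving_comp_perm {ι : Type*} [Fintype ι] (π : Equiv.Perm ι) :
    MeasurePreserving (fun u : ι → ℝ => u ∘ π) (Measure.pi fun _ => unif)
      (Measure.pi fun _ => unif) := by
  convert measurePreserving_piCongrLeft (fun _ : ι => unif) π.symm using 1
  ext u i
  obtain ⟨j, rfl⟩ := π.symm.surjective i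
  simp [MeasurableEquiv.piCongrLeft]

lemma sum_BE_perm {N k : ℕ} {E : Finset (Finset (Fin N))} (hk : E.card = k)
    {u : Finset (Fin N) ⊕ Finset (Fin N) → ℝ} (hu : Function.Injective u) :
    ∑ π : Equiv.Perm (Ends E), BE E (chord (u ∘ Equiv.Perm.ofSubtype π))
      = ∑ τ : Ends E ≃ Fin (2 * k), BE E (chord (extendPos fun p => ((τ p : ℕ) : ℝ))) := by
  obtain ⟨τ₀, hτ₀⟩ := exists_equiv_lt_iff (m := 2 * k) (by rw [← Nat.card_eq_fintype_card, card_ends, hk])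
    (hu.comp Subtype.val_injective : Function.Injective fun p : Ends E => u p.1)
  refine Fintype.sum_equiv (Equiv.equivCongr (Equiv.refl _) τ₀) _ _ fun π => ?_
  refine BE_chord_congr fun p r => ?_
  have h := hτ₀ (π p) (π r)
  simp only [Function.comp_apply, Equiv.Perm.ofSubtype_apply_coe, extendPos, p.2, r.2, dif_pos,
    Subtype.coe_eta, Nat.cast_lt]
  exact h.symm

lemma factorial_mul_bT {N k : ℕ} {E : Finset (Finset (Fin N))} (hk : E.card = k) :
    (2 * k).factorial * bT E
      = ∑ τ : Ends E ≃ Fin (2 * k), BE E (chord (extendPos fun p => ((τ p : ℕ) : ℝ))) := by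
  have hInt : ∀ π : Equiv.Perm (Ends E),
      ∫ u, BE E (chord (u ∘ Equiv.Perm.ofSubtype π)) ∂(Measure.pi fun _ => unif) = bT E := by
    intro π
    rw [bT_eq_integral]
    have hmp := measurePreserving_comp_perm (Equiv.Perm.ofSubtype π)
    conv_rhs => rw [← hmp.map_eq]
    exact (integral_map hmp.measurable.aemeasurable
      ((measurable_BE E).comp measurable_chord).aestronglyMeasurable).symm
  have hsum : ∑ _π : Equiv.Perm (Ends E), bT E = (2 * k).factorial * bT E := by
    rw [Finset.sum_const, Finset.card_univ, Fintype.card_perm,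
      ← Nat.card_eq_fintype_card, card_ends, hk, nsmul_eq_mul]
  rw [← hsum, ← Finset.sum_congr rfl fun π _ => hInt π, ← integral_finsetSum]
  · rw [integral_congr_ae (g := fun _ => ∑ τ : Ends E ≃ Fin (2 * k),
      BE E (chord (extendPos fun p => ((τ p : ℕ) : ℝ))))]
    · simp
    · filter_upwards [ae_injective] with u hu
      exact sum_BE_perm hk hu
  · intro π _
    exact (measurePreserving_comp_perm (Equiv.Perm.ofSubtype π)).integrable_comp_of_integrable
      (integrable_BE_chord E)

lemma bMulti_two_eq {N q k : ℕ} (hq : Even q) {E : Finset (Finset (Fin N))}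
    (hE : ∀ e ∈ E, e.card = q) (hk : E.card = k) :
    2 ^ k * bMulti q (fun e => if e ∈ E then 2 else 0) (2 * k) = (2 * k).factorial * bT E := by
  rw [factorial_mul_bT hk, ← sum_signB_eq hk]
  exact Finset.sum_congr rfl fun τ _ => signB_ofFn_eq hq hE hk τ

lemma rho_pow {q : ℕ} (hq2 : 2 ≤ q) (β : ℝ) :
    rho q β ^ (q - 1) = (q - 1).factorial * β ^ 2 / 2 ^ (q + 1) := by
  have hc : (q : ℝ) - 1 = ((q - 1 : ℕ) : ℝ) := by
    rw [Nat.cast_sub (by omega), Nat.cast_one]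
  rw [rho, hc, Real.rpow_inv_natCast_pow (by positivity) (by omega)]

lemma muVD_zero {q n v : ℕ} (hq : Even q) (hq2 : 2 ≤ q) (hv : 1 ≤ v) (hn : 1 ≤ n) (β : ℝ) :
    muVD q n β v 0 = mu q β v := by
  have hn0 : (n : ℝ) ≠ 0 := by positivity
  rw [muVD, mu, sum_isMultiHG_zero hv hq2 (fun r =>
    (β * ((2 : ℝ) ^ (q / 2))⁻¹ * sigma q n) ^ (∑ e, r e) * bMulti q r (∑ e, r e)
      / (∑ e, r e).factorial), Finset.mul_sum, Finset.mul_sum]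
  refine Finset.sum_congr rfl fun E hE => ?_
  obtain ⟨hcard, -, hk⟩ := (Finset.mem_filter.1 hE).2
  have hsum : ∑ e : Finset (Fin v), (if e ∈ E then 2 else 0) = 2 * E.card := by
    rw [Finset.sum_ite_mem, Finset.univ_inter, Finset.sum_const, smul_eq_mul, mul_comm]
  have hb := bMulti_two_eq hq hcard rfl
  have hfac : ((2 * E.card).factorial : ℝ) ≠ 0 := by positivity
  have hb' : bMulti q (fun e => if e ∈ E then 2 else 0) (2 * E.card)
      = (2 * E.card).factorial * bT E / 2 ^ E.card := by
    rw [← hb]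
    field_simp
  simp only [hsum]
  rw [hb', pow_mul, sq_coupling q n hq β, ← hk, pow_mul, pow_mul, rho_pow hq2, div_pow, mul_pow]
  field_simp

lemma mu_one {q : ℕ} (hq2 : 2 ≤ q) (β : ℝ) : mu q β 1 = 1 := by
  have ht : trees q 1 = {∅} := by
    ext E
    rw [trees, Finset.mem_filter, Finset.mem_singleton]
    constructor
    · rintro ⟨-, -, -, h⟩
      rcases Nat.mul_eq_zero.1 (h.trans (Nat.sub_self 1)) with h | h
      · omega
      · exact Finset.card_eq_zero.1 h
    · rintro rfl
      refine ⟨Finset.mem_univ _, by simp, fun a b => ?_, by simp⟩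
      rw [Subsingleton.elim a b]
  rw [mu, ht, Finset.sum_singleton, bT]
  simp [BE]

lemma abs_mu_succ_le {q : ℕ} (hq : Even q) (hq2 : 2 ≤ q) {β : ℝ}
    (hβ : ((q - 1).factorial * β ^ 2 / 2 ^ (q + 1) : ℝ) ≤ (1 / 10 ^ 4) ^ (q - 1)) (v : ℕ) :
    |mu q β (v + 1)| ≤ (1 / 100) ^ v := by
  rcases Nat.eq_zero_or_pos v with rfl | hv
  · simp [mu_one hq2]
  have h := abs_muVD_le hq hq2 (Nat.le_add_left 1 v) le_rfl 0 (by norm_num) hβ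
  rw [muVD_zero hq hq2 (Nat.le_add_left 1 v) le_rfl] at h
  refine h.trans ?_
  simp only [Nat.add_sub_cancel, add_zero, pow_zero, mul_one]
  obtain ⟨w, rfl⟩ : ∃ w, v = w + 1 := ⟨v - 1, by omega⟩
  calc (9 : ℝ) ^ (w + 1 + 1) * (1 / 10 ^ 4) ^ (w + 1) = (81 / 10 ^ 4) * (9 / 10 ^ 4) ^ w := by
        rw [div_pow, div_pow, one_pow, pow_succ, pow_succ, pow_succ]
        field_simp
        ring
    _ ≤ (1 / 100) * (1 / 100) ^ w := by
        refine mul_le_mul (by norm_num) (pow_le_pow_left₀ (by norm_num) (by norm_num) w)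
          (by positivity) (by norm_num)
    _ = (1 / 100) ^ (w + 1) := by rw [pow_succ, mul_comm]

lemma abs_tsum_muVD_le {q n v : ℕ} (hq : Even q) (hq2 : 2 ≤ q) {β : ℝ}
    (hβ : ((q - 1).factorial * β ^ 2 / 2 ^ (q + 1) : ℝ) ≤ (1 / 10 ^ 4) ^ (q - 1))
    (hv : v ∈ Finset.Icc 1 n) :
    |n * ∑' Δ : ℕ, muVD q n β v (Δ + 1)| ≤ 2 * (1 / 100) ^ v := by
  obtain ⟨hv1, hvn⟩ := Finset.mem_Icc.1 hv
  have hn : 1 ≤ n := hv1.trans hvn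
  have hn0 : (0 : ℝ) < n := by exact_mod_cast hn
  have hvn' : (v : ℝ) / n ≤ 1 := (div_le_one hn0).2 (by exact_mod_cast hvn)
  have hterm : ∀ Δ : ℕ, ‖muVD q n β v (Δ + 1)‖
      ≤ (9 ^ v * (1 / 10 ^ 4) ^ v * ((v : ℝ) / n)) * (1 / 10 ^ 4) ^ Δ := by
    intro Δ
    rw [Real.norm_eq_abs]
    refine (abs_muVD_le hq hq2 hv1 hn (Δ + 1) (by norm_num) hβ).trans ?_
    rw [show v - 1 + (Δ + 1) = v + Δ by omega, pow_add, pow_succ ((v : ℝ) / n)]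
    have h1 : ((v : ℝ) / n) ^ Δ ≤ 1 := pow_le_one₀ (by positivity) hvn'
    calc (9 : ℝ) ^ v * ((1 / 10 ^ 4) ^ v * (1 / 10 ^ 4) ^ Δ) * (((v : ℝ) / n) ^ Δ * ((v : ℝ) / n))
        = (9 ^ v * (1 / 10 ^ 4) ^ v * ((v : ℝ) / n) * (1 / 10 ^ 4) ^ Δ) * ((v : ℝ) / n) ^ Δ := by ring
      _ ≤ (9 ^ v * (1 / 10 ^ 4) ^ v * ((v : ℝ) / n) * (1 / 10 ^ 4) ^ Δ) * 1 := by gcongr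
      _ = _ := mul_one _
  have hgeo : HasSum (fun Δ : ℕ => (9 ^ v * (1 / 10 ^ 4) ^ v * ((v : ℝ) / n)) * (1 / 10 ^ 4) ^ Δ)
      ((9 ^ v * (1 / 10 ^ 4) ^ v * ((v : ℝ) / n)) * (1 - 1 / 10 ^ 4)⁻¹) :=
    (hasSum_geometric_of_lt_one (by norm_num) (by norm_num)).mul_left _
  have hle := tsum_of_norm_bounded hgeo hterm
  rw [Real.norm_eq_abs] at hle
  rw [abs_mul, Nat.abs_cast]
  have hv2 : (v : ℝ) ≤ 2 ^ v := by exact_mod_cast Nat.lt_two_pow_self.le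
  calc (n : ℝ) * |∑' Δ : ℕ, muVD q n β v (Δ + 1)|
      ≤ n * ((9 ^ v * (1 / 10 ^ 4) ^ v * ((v : ℝ) / n)) * (1 - 1 / 10 ^ 4)⁻¹) := by gcongr
    _ = (9 ^ v * (1 / 10 ^ 4) ^ v) * v * (1 - 1 / 10 ^ 4)⁻¹ := by field_simp
    _ ≤ (9 ^ v * (1 / 10 ^ 4) ^ v) * 2 ^ v * 2 := by
        gcongr
        norm_num
    _ = 2 * (18 / 10 ^ 4) ^ v := by
        rw [← mul_pow, ← mul_pow]
        norm_num [mul_comm]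
    _ ≤ 2 * (1 / 100) ^ v :=
        mul_le_mul_of_nonneg_left (pow_le_pow_left₀ (by norm_num) (by norm_num) v) two_pos.le

lemma Mfun_eq_genFun {q n : ℕ} (hq : Even q) (hq2 : 2 ≤ q) (hn : 1 ≤ n) (β : ℝ) :
    Mfun q n β = genFun (fun v => mu q β (v + 1))
      (fun v => n * ∑' Δ : ℕ, muVD q n β v (Δ + 1)) n := by
  funext z
  rw [Mfun, M0, DeltaM, genFun, perturb, Finset.mul_sum]
  congr 2
  · congr 1
    refine tsum_congr fun v => ?_
    rw [muVD_zero hq hq2 (Nat.le_add_left 1 v) hn]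
  · refine Finset.sum_congr rfl fun v _ => ?_
    rw [tsum_mul_right, Complex.ofReal_mul, Complex.ofReal_tsum, Complex.ofReal_natCast, mul_assoc]

lemma exists_coupling_bound {q : ℕ} {δ : ℝ} (hδ : 0 < δ) :
    ∃ βs : ℝ, 0 < βs ∧ ∀ β : ℝ, |β| ≤ βs →
      ((q - 1).factorial * β ^ 2 / 2 ^ (q + 1) : ℝ) ≤ δ := by
  have hpos : (0 : ℝ) < δ * 2 ^ (q + 1) / (q - 1).factorial := by positivity
  refine ⟨Real.sqrt (δ * 2 ^ (q + 1) / (q - 1).factorial), Real.sqrt_pos.2 hpos, fun β hβ => ?_⟩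
  have h := (sq_le_sq₀ (abs_nonneg β) (Real.sqrt_nonneg _)).2 hβ
  rw [sq_abs, Real.sq_sqrt hpos.le, le_div_iff₀ (by positivity)] at h
  rw [div_le_iff₀ (by positivity)]
  linarith

/-- For small enough `β*` and `|β| ≤ β*`, with `t* ∈ (1/2,3/2)` the unique
solution of `t* Φ'(t*) = 1`, one has `lim_{n→∞} (1/n) log Mₙ = −log t* + Φ(t*)`. -/
theorem Mcoef_limit (q : ℕ) (hq : Even q) (hq2 : 2 ≤ q) :
    ∃ βs : ℝ, 0 < βs ∧ ∀ β : ℝ, |β| ≤ βs →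
      (∃! t : ℝ, t ∈ Set.Ioo (1 / 2 : ℝ) (3 / 2) ∧ t * deriv (PhiR q β) t = 1) ∧
      ∀ t : ℝ, t ∈ Set.Ioo (1 / 2 : ℝ) (3 / 2) → t * deriv (PhiR q β) t = 1 →
        Tendsto (fun n : ℕ => Real.log (Mcoef q n β).re / n) atTop
          (nhds (- Real.log t + PhiR q β t)) := by
  obtain ⟨βs, hβs, hbound⟩ := exists_coupling_bound (q := q) (δ := (1 / 10 ^ 4) ^ (q - 1))
    (by positivity)
  refine ⟨βs, hβs, fun β hβ => ?_⟩
  have h0 : mu q β (0 + 1) = 1 := mu_one hq2 β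
  have ha := abs_mu_succ_le hq hq2 (hbound β hβ)
  refine ⟨existsUnique_saddle (a := fun v => mu q β (v + 1)) h0 ha, fun t ht hst => ?_⟩
  have hlim := tendsto_log_coeff (a := fun v => mu q β (v + 1))
    (c := fun n v => n * ∑' Δ : ℕ, muVD q n β v (Δ + 1)) h0 ha
    (fun n v hv => abs_tsum_muVD_le hq hq2 (hbound β hβ) hv) ht
    ((mul_deriv_tsum_eq ha ht).symm.trans hst)
  refine hlim.congr' ?_
  filter_upwards [eventually_ge_atTop 1] with n hn
  rw [Mcoef, Mfun_eq_genFun hq hq2 hn]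

end SYK
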